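/- Let c = (m_c, n_c, (p_c,q_c), s_c, t_c) be an unresolved configuration pair with max{m_c, n_c} > P₁(K), where P₁(K) = 14K⁶. Then c lies in a unique belt of thickness P₂(K) = 6K⁴ and slope α/β with co-prime α, β ∈ [1, K²]; that is, there exist unique co-prime α, β ∈ [1, K²] with |α·m_c − β·n_c| ≤ 6K⁴. -/

import Mathlib

/-- A deterministic weighted real-time one-counter automaton (dwROCA) over
alphabet `A` and field `S`.  `next q b a`, `upd q b a`, `wt q b a` give the
target state, counter update and (nonzero) weight of the unique transition
from state `q` reading letter `a` with counter-status `b` (`true` = counter is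
zero). -/
structure DWROCA (A : Type) (S : Type) [Field S] where
  Q : Type
  fin : Fintype Q
  q0 : Q
  s0 : S
  s0_ne : s0 ≠ 0
  next : Q → Bool → A → Q
  upd : Q → Bool → A → ℤ
  wt : Q → Bool → A → S
  upd_mem : ∀ q b a, upd q b a ∈ ({-1, 0, 1} : Set ℤ)
  no_dec_on_zero : ∀ q a, upd q true a ≠ -1
  wt_ne : ∀ q b a, wt q b a ≠ 0

attribute [instance] DWROCA.fin

/-- Configurations: a state, a counter value and a weight. -/
abbrev DWROCA.Cfg {A S : Type} [Field S] (M : DWROCA A S) : Type := M.Q × ℕ × S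

variable {A S : Type} [Field S]

/-- One step of a dwROCA on a configuration. -/
def DWROCA.step (M : DWROCA A S) (c : M.Cfg) (x : A) : M.Cfg :=
  (M.next c.1 (decide (c.2.1 = 0)) x,
   ((c.2.1 : ℤ) + M.upd c.1 (decide (c.2.1 = 0)) x).toNat,
   c.2.2 * M.wt c.1 (decide (c.2.1 = 0)) x)

/-- The run of a dwROCA on a word from a configuration. -/
def DWROCA.run (M : DWROCA A S) (c : M.Cfg) (w : List A) : M.Cfg :=
  w.foldl M.step c

/-- `f(w, c)`: the value assigned to the word `w` by the configuration `c`. -/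
def DWROCA.val (M : DWROCA A S) (c : M.Cfg) (w : List A) : S :=
  (M.run c w).2.2

/-- The initial configuration. -/
def DWROCA.init (M : DWROCA A S) : M.Cfg := (M.q0, 0, M.s0)

/-- The function `f_A : Σ* → S` computed by a dwROCA. -/
def DWROCA.f (M : DWROCA A S) (w : List A) : S := M.val M.init w

/-- One step of the underlying uninitialised weighted automaton `uwa(M)`:
the counter is ignored (nonzero tests are always taken).  Its configurations
are pairs (state, weight). -/
def DWROCA.ustep (M : DWROCA A S) (c : M.Q × S) (x : A) : M.Q × S :=
  (M.next c.1 false x, c.2 * M.wt c.1 false x)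

/-- The value assigned to a word by a configuration of `uwa(M)`. -/
def DWROCA.uval (M : DWROCA A S) (c : M.Q × S) (w : List A) : S :=
  (w.foldl M.ustep c).2

/-- `k`-equivalence of configurations of two dwROCAs. -/
def kEquiv (M N : DWROCA A S) (c : M.Cfg) (d : N.Cfg) (k : ℕ) : Prop :=
  ∀ w : List A, w.length ≤ k → M.val c w = N.val d w

/-- `k`-equivalence of a configuration of `M` with a configuration of the
underlying weighted automaton `uwa(N)`. -/
def kEquivU (M N : DWROCA A S) (c : M.Cfg) (d : N.Q × S) (k : ℕ) : Prop :=
  ∀ w : List A, w.length ≤ k → M.val c w = N.uval d w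

/-- Membership in `NWA` (relative to the pair `A₁`, `A₂`): a configuration of
`M` (where `M` is `A₁` or `A₂`) not `K`-equivalent to any configuration of
`uwa(A₁) ∪ uwa(A₂)`. -/
def inNWA (A₁ A₂ M : DWROCA A S) (c : M.Cfg) (K : ℕ) : Prop :=
  (∀ d : A₁.Q × S, ¬ kEquivU M A₁ c d K) ∧ (∀ d : A₂.Q × S, ¬ kEquivU M A₂ c d K)

/-- `dist(c)`: least length of a word taking `c` into `NWA` (`⊤` if none). -/
noncomputable def distNWA (A₁ A₂ M : DWROCA A S) (c : M.Cfg) (K : ℕ) : ℕ∞ :=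
  sInf {n : ℕ∞ | ∃ w : List A, (w.length : ℕ∞) = n ∧ inNWA A₁ A₂ M (M.run c w) K}

/-- A configuration pair is surely-equivalent if the two configurations are
`K`-equivalent and both have infinite distance to `NWA`. -/
def surelyEq (A₁ A₂ : DWROCA A S) (c : A₁.Cfg) (d : A₂.Cfg) (K : ℕ) : Prop :=
  kEquiv A₁ A₂ c d K ∧ distNWA A₁ A₂ A₁ c K = ⊤ ∧ distNWA A₁ A₂ A₂ d K = ⊤

/-- A configuration pair is surely-nonequivalent if the two configurations are
not `K`-equivalent or have different distances to `NWA`. -/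
def surelyNonEq (A₁ A₂ : DWROCA A S) (c : A₁.Cfg) (d : A₂.Cfg) (K : ℕ) : Prop :=
  ¬ kEquiv A₁ A₂ c d K ∨ distNWA A₁ A₂ A₁ c K ≠ distNWA A₁ A₂ A₂ d K

/-- A configuration pair is unresolved if the configurations are `K`-equivalent
and have equal finite distances to `NWA`. -/
def unresolved (A₁ A₂ : DWROCA A S) (c : A₁.Cfg) (d : A₂.Cfg) (K : ℕ) : Prop :=
  kEquiv A₁ A₂ c d K ∧ distNWA A₁ A₂ A₁ c K = distNWA A₁ A₂ A₂ d K ∧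
    distNWA A₁ A₂ A₁ c K ≠ ⊤

/-- `w` is a minimal-length witness distinguishing `A₁` and `A₂`. -/
def IsMinWitness (A₁ A₂ : DWROCA A S) (w : List A) : Prop :=
  A₁.f w ≠ A₂.f w ∧ ∀ v : List A, A₁.f v ≠ A₂.f v → w.length ≤ v.length

/-- The `i`-th configuration pair `c_i` of the run of `w` from the initial
configuration pair. -/
def pairAt (A₁ A₂ : DWROCA A S) (w : List A) (i : ℕ) : A₁.Cfg × A₂.Cfg :=
  (A₁.run A₁.init (w.take i), A₂.run A₂.init (w.take i))

/-- Applying a sequence of transition pairs (determined, by determinism, by a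
word) to a configuration pair. -/
def runPair (A₁ A₂ : DWROCA A S) (c : A₁.Cfg × A₂.Cfg) (w : List A) :
    A₁.Cfg × A₂.Cfg :=
  (A₁.run c.1 w, A₂.run c.2 w)

/-- A configuration pair lies in the belt of slope `α/β` and thickness `d`. -/
def inBelt (α β d : ℕ) {A₁ A₂ : DWROCA A S} (c : A₁.Cfg × A₂.Cfg) : Prop :=
  |(α : ℤ) * (c.1.2.1 : ℤ) - (β : ℤ) * (c.2.2.1 : ℤ)| ≤ (d : ℤ)

/-- Two configuration pairs are `(α/β)`-related: same state pairs and same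
value of `α·m - β·n`. -/
def abRelated (α β : ℕ) {A₁ A₂ : DWROCA A S} (c c' : A₁.Cfg × A₂.Cfg) : Prop :=
  c.1.1 = c'.1.1 ∧ c.2.1 = c'.2.1 ∧
    (α : ℤ) * (c.1.2.1 : ℤ) - (β : ℤ) * (c.2.2.1 : ℤ) =
      (α : ℤ) * (c'.1.2.1 : ℤ) - (β : ℤ) * (c'.2.2.1 : ℤ)

namespace DWROCA

/-! ### Runs without weights -/

/-- One step on a state-counter pair, with the weight forgotten. -/
def cstep (M : DWROCA A S) (c : M.Q × ℕ) (x : A) : M.Q × ℕ :=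
  (M.next c.1 (decide (c.2 = 0)) x, ((c.2 : ℤ) + M.upd c.1 (decide (c.2 = 0)) x).toNat)

/-- The run on a word of a state-counter pair. -/
def crun (M : DWROCA A S) (c : M.Q × ℕ) (w : List A) : M.Q × ℕ := w.foldl M.cstep c

/-- The state reached on a word when all counter tests are answered by nonzero. -/
def st (M : DWROCA A S) (q : M.Q) (w : List A) : M.Q := w.foldl (fun q x => M.next q false x) q

/-- The counter effect of a word when all counter tests are answered by nonzero. -/
def ef (M : DWROCA A S) : M.Q → List A → ℤ
  | _, [] => 0
  | q, x :: w => M.upd q false x + ef M (M.next q false x) w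

variable (M : DWROCA A S)

@[simp] lemma crun_nil (c : M.Q × ℕ) : M.crun c [] = c := rfl

@[simp] lemma crun_cons (c : M.Q × ℕ) (x : A) (w : List A) :
    M.crun c (x :: w) = M.crun (M.cstep c x) w := rfl

lemma crun_append (c : M.Q × ℕ) (u v : List A) :
    M.crun c (u ++ v) = M.crun (M.crun c u) v := by
  simp [crun]

@[simp] lemma st_nil (q : M.Q) : M.st q [] = q := rfl

@[simp] lemma st_cons (q : M.Q) (x : A) (w : List A) :
    M.st q (x :: w) = M.st (M.next q false x) w := rfl

lemma st_append (q : M.Q) (u v : List A) : M.st q (u ++ v) = M.st (M.st q u) v := by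
  simp [st]

@[simp] lemma ef_nil (q : M.Q) : M.ef q [] = 0 := rfl

@[simp] lemma ef_cons (q : M.Q) (x : A) (w : List A) :
    M.ef q (x :: w) = M.upd q false x + M.ef (M.next q false x) w := rfl

lemma ef_append (q : M.Q) (u v : List A) :
    M.ef q (u ++ v) = M.ef q u + M.ef (M.st q u) v := by
  induction u generalizing q with
  | nil => simp
  | cons x u ih => simp [ih, add_assoc]

lemma abs_upd_le (q : M.Q) (b : Bool) (x : A) : |M.upd q b x| ≤ 1 := by
  have h := M.upd_mem q b x
  simp only [Set.mem_insert_iff, Set.mem_singleton_iff] at h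
  rcases h with h | h | h <;> simp [h]

lemma abs_ef_le (q : M.Q) (w : List A) : |M.ef q w| ≤ w.length := by
  induction w generalizing q with
  | nil => simp
  | cons x w ih =>
    have h1 := M.abs_upd_le q false x
    have h2 := ih (M.next q false x)
    have h3 := abs_add_le (M.upd q false x) (M.ef (M.next q false x) w)
    simp only [ef_cons, List.length_cons]
    push_cast
    linarith

lemma ef_le (q : M.Q) (w : List A) : M.ef q w ≤ w.length := (abs_le.1 (M.abs_ef_le q w)).2

lemma neg_le_ef (q : M.Q) (w : List A) : -(w.length : ℤ) ≤ M.ef q w :=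
  (abs_le.1 (M.abs_ef_le q w)).1

lemma cstep_snd (c : M.Q × ℕ) (x : A) :
    ((M.cstep c x).2 : ℤ) = c.2 + M.upd c.1 (decide (c.2 = 0)) x := by
  have h := abs_le.1 (M.abs_upd_le c.1 (decide (c.2 = 0)) x)
  have h0 : 0 ≤ (c.2 : ℤ) + M.upd c.1 (decide (c.2 = 0)) x := by
    rcases Nat.eq_zero_or_pos c.2 with hc | hc
    · have h1 := M.no_dec_on_zero c.1 x
      have h2 := M.upd_mem c.1 true x
      simp only [Set.mem_insert_iff, Set.mem_singleton_iff] at h2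
      simp only [hc, decide_true] at *
      rcases h2 with h2 | h2 | h2 <;> simp_all
    · omega
  simp [cstep, h0]

lemma cstep_snd_le (c : M.Q × ℕ) (x : A) :
    (M.cstep c x).2 ≤ c.2 + 1 ∧ c.2 ≤ (M.cstep c x).2 + 1 := by
  have h := abs_le.1 (M.abs_upd_le c.1 (decide (c.2 = 0)) x)
  have h1 := M.cstep_snd c x
  omega

/-- While the counter stays positive, a run follows `st` and `ef`. -/
lemma crun_of_pos (c : M.Q × ℕ) (w : List A)
    (h : ∀ i < w.length, 1 ≤ (M.crun c (w.take i)).2) :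
    (M.crun c w).1 = M.st c.1 w ∧ ((M.crun c w).2 : ℤ) = c.2 + M.ef c.1 w := by
  induction w generalizing c with
  | nil => simp
  | cons x w ih =>
    have hc : c.2 ≠ 0 := by
      have := h 0 (by simp)
      simp at this; omega
    have h1 : (M.cstep c x).1 = M.next c.1 false x := by simp [cstep, hc]
    have h2 := M.cstep_snd c x
    simp only [hc, decide_false] at h2
    have := ih (M.cstep c x) (fun i hi => by simpa using h (i + 1) (by simpa using hi))
    rw [h1, h2] at this
    simp only [crun_cons, st_cons, ef_cons]
    exact ⟨this.1, by rw [this.2]; ring⟩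

/-- A word not longer than the counter value is read without a zero test. -/
lemma crun_of_length_le (q : M.Q) (n n' : ℕ) (w : List A) (h : w.length ≤ n)
    (hn : (n' : ℤ) = n + M.ef q w) : M.crun (q, n) w = (M.st q w, n') := by
  have key : ∀ (w : List A) (c : M.Q × ℕ), w.length ≤ c.2 →
      ∀ i < w.length, 1 ≤ (M.crun c (w.take i)).2 := by
    intro w
    induction w with
    | nil => simp
    | cons x w ih =>
      intro c hc i hi
      simp only [List.length_cons] at hc hi
      cases i with
      | zero => simp; omega
      | succ i =>
        have := M.cstep_snd_le c x
        simpa using ih (M.cstep c x) (by omega) i (by omega)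
  have h1 := M.crun_of_pos (q, n) w (key w (q, n) h)
  refine Prod.ext h1.1 ?_
  have := h1.2
  simp only at this ⊢
  omega

/-- `n` copies of a word. -/
def wpow (w : List A) : ℕ → List A
  | 0 => []
  | n + 1 => w ++ wpow w n

@[simp] lemma length_wpow (w : List A) (n : ℕ) : (wpow w n).length = n * w.length := by
  induction n with
  | zero => simp [wpow]
  | succ n ih => simp [wpow, ih]; ring

lemma st_wpow {q : M.Q} {w : List A} (h : M.st q w = q) (n : ℕ) : M.st q (wpow w n) = q := by
  induction n with
  | zero => simp [wpow]
  | succ n ih => simp [wpow, st_append, h, ih]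

lemma ef_wpow {q : M.Q} {w : List A} (h : M.st q w = q) (n : ℕ) :
    M.ef q (wpow w n) = n * M.ef q w := by
  induction n with
  | zero => simp [wpow]
  | succ n ih => simp [wpow, ef_append, h, ih]; ring

/-- Iterating a closed walk that is short compared to the counter values before and after. -/
lemma crun_wpow {q : M.Q} {w : List A} (h : M.st q w = q) (n y y' : ℕ)
    (hy : w.length ≤ y) (hy' : w.length ≤ y') (hn : (y' : ℤ) = y + n * M.ef q w) :
    M.crun (q, y) (wpow w n) = (q, y') := by
  induction n generalizing y with
  | zero =>
    simp only [wpow, crun_nil, Prod.mk.injEq, true_and]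
    push_cast at hn; omega
  | succ n ih =>
    obtain ⟨z, hz⟩ : ∃ z : ℕ, (z : ℤ) = y + M.ef q w :=
      ⟨((y : ℤ) + M.ef q w).toNat, by have := M.neg_le_ef q w; omega⟩
    rw [wpow, crun_append, M.crun_of_length_le q y z w hy hz, h]
    rcases Nat.eq_zero_or_pos n with rfl | hpos
    · simp only [wpow, crun_nil, Prod.mk.injEq, true_and]
      push_cast at hn; omega
    · refine ih z ?_ (by rw [hz, hn]; push_cast; ring)
      rcases le_or_gt 0 (M.ef q w) with he | he
      · omega
      · have : (n : ℤ) * M.ef q w ≤ 0 := by nlinarith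
        push_cast at hn
        have : (y' : ℤ) ≤ z := by rw [hz, hn]; linarith
        omega

end DWROCA

namespace DWROCA

/-! ### Pigeonhole arguments on words -/

lemma exists_repeat {T : Type*} [Fintype T] (n : ℕ) (h : Fintype.card T ≤ n) (f : ℕ → T) :
    ∃ i j, i < j ∧ j ≤ n ∧ f i = f j := by
  obtain ⟨i, j, hne, he⟩ := Fintype.exists_ne_map_eq_of_card_lt
    (fun i : Fin (n + 1) => f i) (by simpa using Nat.lt_succ_of_le h)
  rcases lt_or_gt_of_ne hne with hlt | hlt
  · exact ⟨i, j, hlt, Nat.lt_succ_iff.1 j.2, he⟩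
  · exact ⟨j, i, hlt, Nat.lt_succ_iff.1 i.2, he.symm⟩

/-- Cutting a word at two positions. -/
lemma exists_split (w : List A) {i j : ℕ} (hij : i < j) (hj : j ≤ w.length) :
    ∃ u v x, w = u ++ v ++ x ∧ u = w.take i ∧ u ++ v = w.take j ∧ u.length = i ∧
      u.length + v.length = j := by
  have h : w.take i ++ (w.take j).drop i = w.take j := by
    conv_rhs => rw [← List.take_append_drop i (w.take j)]
    rw [List.take_take, min_eq_left hij.le]
  refine ⟨w.take i, (w.take j).drop i, w.drop j, ?_, rfl, h, ?_, ?_⟩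
  · rw [h, List.take_append_drop]
  · simp; omega
  · simp; omega

variable (M : DWROCA A S)

/-- Every word can be shortened while keeping the end state and the effect modulo `g`. -/
lemma exists_short_mod (q : M.Q) (w : List A) {g : ℕ} (hg : 1 ≤ g) :
    ∃ w' : List A, M.st q w' = M.st q w ∧ M.ef q w' ≡ M.ef q w [ZMOD g] ∧
      w'.length < Fintype.card M.Q * g := by
  induction hn : w.length using Nat.strong_induction_on generalizing w with
  | _ n ih =>
    rcases lt_or_ge w.length (Fintype.card M.Q * g) with h | h
    · exact ⟨w, rfl, Int.ModEq.refl _, h⟩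
    · have : NeZero g := ⟨by omega⟩
      obtain ⟨i, j, hij, hj, he⟩ := exists_repeat (T := M.Q × ZMod g) w.length
        (by simpa [ZMod.card] using h)
        (fun i => (M.st q (w.take i), (M.ef q (w.take i) : ZMod g)))
      obtain ⟨u, v, x, hw, hu, hv, hul, hvl⟩ := exists_split w hij hj
      rw [← hu, ← hv, Prod.mk.injEq, ZMod.intCast_eq_intCast_iff] at he
      have hlen : w.length = u.length + v.length + x.length := by rw [hw]; simp [add_assoc]
      obtain ⟨w', h1, h2, h3⟩ := ih (u ++ x).length (by simp; omega) (u ++ x) rfl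
      refine ⟨w', ?_, ?_, h3⟩
      · rw [h1, hw, M.st_append, M.st_append _ (u ++ v), he.1]
      · refine h2.trans ?_
        rw [hw, M.ef_append, M.ef_append _ (u ++ v), he.1]
        exact he.2.add_right _

lemma exists_short (q : M.Q) (w : List A) :
    ∃ w' : List A, M.st q w' = M.st q w ∧ w'.length < Fintype.card M.Q := by
  obtain ⟨w', h1, -, h2⟩ := M.exists_short_mod q w le_rfl
  exact ⟨w', h1, by simpa using h2⟩

/-- If no short closed walk at a visited state increases `x * effect - y * length`, then this
quantity is dominated by its value on a simple path. -/
lemma exists_short_of_loops (x y : ℤ) (q : M.Q) (w : List A)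
    (h : ∀ i v, v.length ≤ Fintype.card M.Q → M.st (M.st q (w.take i)) v = M.st q (w.take i) →
      x * M.ef (M.st q (w.take i)) v - y * v.length ≤ 0) :
    ∃ w' : List A, M.st q w' = M.st q w ∧ w'.length < Fintype.card M.Q ∧
      x * M.ef q w - y * w.length ≤ x * M.ef q w' - y * w'.length := by
  induction hn : w.length using Nat.strong_induction_on generalizing w with
  | _ n ih =>
    rcases lt_or_ge w.length (Fintype.card M.Q) with hk | hk
    · exact ⟨w, rfl, hk, by rw [hn]⟩
    · obtain ⟨i, j, hij, hj, he⟩ := exists_repeat (T := M.Q) (Fintype.card M.Q) le_rfl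
        (fun i => M.st q (w.take i))
      obtain ⟨u, v, z, hw, hu, hv, hul, hvl⟩ := exists_split w hij (hj.trans hk)
      have he' : M.st (M.st q u) v = M.st q u := by
        rw [← M.st_append, hv, hu]; exact he.symm
      have hlen : w.length = u.length + v.length + z.length := by rw [hw]; simp [add_assoc]
      obtain ⟨w', h1, h2, h3⟩ := ih (u ++ z).length (by simp; omega) (u ++ z) (by
        intro l t ht hcl
        rcases le_or_gt l u.length with hl | hl
        · have : (u ++ z).take l = w.take l := by
            rw [hw, List.take_append_of_le_length hl, List.append_assoc,
              List.take_append_of_le_length hl]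
          rw [this] at hcl ⊢
          exact h l t ht hcl
        · obtain ⟨m, rfl⟩ := Nat.exists_eq_add_of_lt hl
          have e1 : M.st q ((u ++ z).take (u.length + m + 1)) =
              M.st q (w.take (u.length + v.length + m + 1)) := by
            rw [hw, add_assoc, List.take_length_add_append,
              show u.length + v.length + m + 1 = (u ++ v).length + (m + 1) by simp; ring,
              List.take_length_add_append, M.st_append, M.st_append, M.st_append, he']
          rw [e1] at hcl ⊢
          exact h _ t ht hcl) rfl
      refine ⟨w', ?_, h2, le_trans ?_ h3⟩
      · rw [h1, hw, M.st_append, M.st_append, M.st_append, he']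
      · have h4 := h u.length v (by omega) (by rw [hul, ← hu, he'])
        rw [hul, ← hu] at h4
        rw [← hn, hlen, hw, M.ef_append, M.ef_append, M.ef_append, M.st_append, he']
        simp only [List.length_append]
        push_cast
        linarith

/-- A walk with a large effect visits a state with a closed walk whose effect has the
same sign. -/
lemma exists_loop_of_ef (ε : ℤ) (hε : |ε| = 1) (q : M.Q) (w : List A)
    (h : (Fintype.card M.Q : ℤ) ≤ ε * M.ef q w) :
    ∃ i ≤ w.length, ∃ v, v.length ≤ Fintype.card M.Q ∧
      M.st (M.st q (w.take i)) v = M.st q (w.take i) ∧ 0 < ε * M.ef (M.st q (w.take i)) v := by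
  by_contra! hc
  obtain ⟨w', -, h2, h3⟩ := M.exists_short_of_loops ε 0 q w (by
    intro i v hv hcl
    rcases le_or_gt i w.length with hi | hi
    · simpa using hc i hi v hv hcl
    · rw [List.take_of_length_le hi.le] at hcl ⊢
      simpa using hc w.length le_rfl v hv (by simpa using hcl))
  have h4 : ε * M.ef q w' ≤ |ε * M.ef q w'| := le_abs_self _
  rw [abs_mul, hε, one_mul] at h4
  have h5 := M.abs_ef_le q w'
  simp only [zero_mul, sub_zero] at h3
  omega

/-- The number-theoretic core of pumping: multiples of `a` in a prescribed class modulo `b`. -/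
lemma exists_mul_modEq {a b : ℕ} (ha : 1 ≤ a) (hb : 1 ≤ b) {e : ℤ}
    (he : (Nat.gcd a b : ℤ) ∣ e) (X : ℕ) :
    ∃ c : ℕ, X ≤ c * a ∧ Nat.gcd a b * (c * a) ≤ Nat.gcd a b * X + a * b ∧
      (b : ℤ) ∣ c * a - e := by
  obtain ⟨e', rfl⟩ := he
  have hg : 0 < Nat.gcd a b := Nat.gcd_pos_of_pos_left _ ha
  obtain ⟨b', hb'⟩ := Nat.gcd_dvd_right a b
  obtain ⟨a', ha'⟩ := Nat.gcd_dvd_left a b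
  have hbez := Nat.gcd_eq_gcd_ab a b
  set g := Nat.gcd a b with hgdef
  set s := Nat.gcdA a b
  set t := Nat.gcdB a b
  have hb'0 : 0 < b' := by
    rcases Nat.eq_zero_or_pos b' with h | h
    · rw [h] at hb'; omega
    · exact h
  set c0 := (X + a - 1) / a with hc0
  have hc1 : X ≤ c0 * a := by
    have := Nat.div_add_mod (X + a - 1) a
    have h2 := Nat.mod_lt (X + a - 1) ha
    rw [← hc0, mul_comm] at this
    omega
  have hc2 : c0 * a + 1 ≤ X + a := by
    have := Nat.div_mul_le_self (X + a - 1) a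
    rw [← hc0] at this
    omega
  set r := (s * e' - c0) % (b' : ℤ) with hr
  have hr0 : 0 ≤ r := Int.emod_nonneg _ (by omega)
  have hr1 : r < b' := Int.emod_lt_of_pos _ (by omega)
  have hr2 := Int.mul_ediv_add_emod (s * e' - c0) (b' : ℤ)
  rw [← hr] at hr2
  obtain ⟨r', hr'⟩ := Int.eq_ofNat_of_zero_le hr0
  refine ⟨c0 + r', ?_, ?_, ?_⟩
  · nlinarith
  · have h1 : r' + 1 ≤ b' := by omega
    have h2 : (c0 + r') * a ≤ X + b' * a := by nlinarith
    calc g * ((c0 + r') * a) ≤ g * (X + b' * a) := Nat.mul_le_mul_left _ h2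
      _ = g * X + a * (g * b') := by ring
      _ = g * X + a * b := by rw [← hb']
  · refine ⟨-(t * e') - a' * ((s * e' - c0) / b'), ?_⟩
    have ea : (a : ℤ) = g * a' := by exact_mod_cast ha'
    have eb : (b : ℤ) = g * b' := by exact_mod_cast hb'
    push_cast
    rw [← hr', show r = s * e' - c0 - b' * ((s * e' - c0) / b') by linarith]
    have : (g : ℤ) * e' = (a * s + b * t) * e' := by rw [← hbez]
    rw [this]
    generalize (s * e' - c0) / (b' : ℤ) = z
    rw [ea, eb]
    ring

end DWROCA

namespace DWROCA

/-! ### Short signed closed walks in each strongly connected component -/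

/-- A choice of closed walks whose effect has the sign of `ε`, at most one for each strongly
connected component, of length at most the size of the component. -/
structure Pumps (M : DWROCA A S) (ε : ℤ) where
  /-- the size of the component -/
  size : M.Q → ℕ
  /-- the components having a closed walk of the required sign -/
  ok : M.Q → Prop
  /-- the base point of the chosen closed walk -/
  base : M.Q → M.Q
  /-- the chosen closed walk -/
  word : M.Q → List A
  sum_size : ∑ c, size c = Fintype.card M.Q
  closed : ∀ c, ok c → M.st (base c) (word c) = base c
  pos : ∀ c, ok c → 0 < ε * M.ef (base c) (word c)
  len : ∀ c, ok c → (word c).length ≤ size c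
  cover : ∀ u v, M.st u v = u → 0 < ε * M.ef u v →
    ∃ c, ok c ∧ (∃ w, M.st u w = base c) ∧ ∃ w, M.st (base c) w = u

variable (M : DWROCA A S)

/-- Mutual reachability of states. -/
def sccSetoid : Setoid M.Q where
  r u v := (∃ w, M.st u w = v) ∧ ∃ w, M.st v w = u
  iseqv :=
    { refl := fun _ => ⟨⟨[], rfl⟩, ⟨[], rfl⟩⟩
      symm := fun h => ⟨h.2, h.1⟩
      trans := by
        rintro u v w ⟨⟨a, ha⟩, b, hb⟩ ⟨⟨c, hc⟩, d, hd⟩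
        exact ⟨⟨a ++ c, by rw [M.st_append, ha, hc]⟩, d ++ b, by rw [M.st_append, hd, hb]⟩ }

/-- A representative of the strongly connected component of a state. -/
noncomputable def rep (u : M.Q) : M.Q := (Quotient.mk M.sccSetoid u).out

lemma mutual_of_rep_eq {u v : M.Q} (h : M.rep u = M.rep v) :
    (∃ w, M.st u w = v) ∧ ∃ w, M.st v w = u := by
  have : Quotient.mk M.sccSetoid u = Quotient.mk M.sccSetoid v := by
    rw [← Quotient.out_eq (Quotient.mk M.sccSetoid u),
      ← Quotient.out_eq (Quotient.mk M.sccSetoid v)]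
    exact congrArg _ h
  exact Quotient.exact this

lemma rep_eq_of_mutual {u v : M.Q} (h : ∃ w, M.st u w = v) (h' : ∃ w, M.st v w = u) :
    M.rep u = M.rep v :=
  congrArg Quotient.out (Quotient.sound (s := M.sccSetoid) ⟨h, h'⟩)

open Classical in
lemma exists_short_closed (ε : ℤ) (u : M.Q) (w : List A) (hcl : M.st u w = u)
    (hpos : 0 < ε * M.ef u w) :
    ∃ b v, M.st b v = b ∧ 0 < ε * M.ef b v ∧ M.rep b = M.rep u ∧
      v.length ≤ Fintype.card {x // M.rep x = M.rep u} := by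
  induction hn : w.length using Nat.strong_induction_on generalizing u w with
  | _ n ih =>
    rcases le_or_gt w.length (Fintype.card {x // M.rep x = M.rep u}) with hk | hk
    · exact ⟨u, w, hcl, hpos, rfl, hk⟩
    · have hrep : ∀ i, M.rep (M.st u (w.take i)) = M.rep u := fun i =>
        M.rep_eq_of_mutual ⟨w.drop i, by rw [← M.st_append, List.take_append_drop, hcl]⟩
          ⟨w.take i, rfl⟩
      obtain ⟨i, j, hij, hj, he⟩ := exists_repeat (T := {x // M.rep x = M.rep u}) _ le_rfl
        (fun i => ⟨M.st u (w.take i), hrep i⟩)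
      obtain ⟨x, v, y, hw, hx, hv, hxl, hvl⟩ := exists_split w hij (hj.trans hk.le)
      have he' : M.st (M.st u x) v = M.st u x := by
        rw [← M.st_append, hv, hx]; exact (congrArg Subtype.val he).symm
      have hlen : w.length = x.length + v.length + y.length := by rw [hw]; simp [add_assoc]
      have hef : M.ef u w = M.ef u (x ++ y) + M.ef (M.st u x) v := by
        rw [hw, M.ef_append, M.ef_append, M.ef_append, M.st_append, he']; ring
      rw [hef, mul_add] at hpos
      rcases lt_or_ge 0 (ε * M.ef (M.st u x) v) with hp | hp
      · have hr : M.rep (M.st u x) = M.rep u := by rw [hx]; exact hrep i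
        obtain ⟨b, z, h1, h2, h3, h4⟩ := ih v.length (by omega) (M.st u x) v he' hp rfl
        simp only [hr] at h3 h4
        exact ⟨b, z, h1, h2, h3, h4⟩
      · refine ih (x ++ y).length (by simp; omega) u (x ++ y) ?_ (by linarith) rfl
        rw [hw, M.st_append, M.st_append, he'] at hcl
        rw [M.st_append, hcl]

open Classical in
lemma nonempty_pumps (ε : ℤ) : Nonempty (M.Pumps ε) := by
  let P : M.Q → M.Q × List A → Prop := fun c p => M.st p.1 p.2 = p.1 ∧ 0 < ε * M.ef p.1 p.2 ∧
    M.rep p.1 = c ∧ p.2.length ≤ Fintype.card {x // M.rep x = c}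
  let f : M.Q → M.Q × List A := fun c => if h : ∃ p, P c p then h.choose else (c, [])
  have hf : ∀ c, (∃ p, P c p) → P c (f c) := fun c h => by
    simp only [f, h, dif_pos]; exact h.choose_spec
  refine ⟨⟨fun c => Fintype.card {x // M.rep x = c}, fun c => ∃ p, P c p, fun c => (f c).1,
    fun c => (f c).2, ?_, fun c h => (hf c h).1, fun c h => (hf c h).2.1,
    fun c h => (hf c h).2.2.2, ?_⟩⟩
  · rw [← Fintype.card_sigma]
    exact Fintype.card_congr (Equiv.sigmaFiberEquiv M.rep)
  · intro u v hcl hpos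
    obtain ⟨b, z, h1, h2, h3, h4⟩ := M.exists_short_closed ε u v hcl hpos
    have hex : ∃ p, P (M.rep u) p := ⟨(b, z), h1, h2, h3, h4⟩
    exact ⟨M.rep u, hex, M.mutual_of_rep_eq (hf _ hex).2.2.1.symm⟩

namespace Pumps

variable {M} {ε : ℤ} (P : M.Pumps ε)

/-- The absolute value of the effect of a chosen closed walk. -/
def gain (c : M.Q) : ℕ := (ε * M.ef (P.base c) (P.word c)).toNat

lemma gain_eq {c : M.Q} (h : P.ok c) : (P.gain c : ℤ) = ε * M.ef (P.base c) (P.word c) :=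
  Int.toNat_of_nonneg (P.pos c h).le

lemma one_le_gain {c : M.Q} (h : P.ok c) : 1 ≤ P.gain c := by
  have := P.gain_eq h
  have := P.pos c h
  omega

lemma gain_le_length (hε : |ε| = 1) {c : M.Q} (h : P.ok c) : P.gain c ≤ (P.word c).length := by
  have h1 := P.gain_eq h
  have h2 := le_abs_self (ε * M.ef (P.base c) (P.word c))
  rw [abs_mul, hε, one_mul] at h2
  have := M.abs_ef_le (P.base c) (P.word c)
  omega

lemma size_le (c : M.Q) : P.size c ≤ Fintype.card M.Q := by
  rw [← P.sum_size]
  exact Finset.single_le_sum (f := P.size) (fun _ _ => Nat.zero_le _) (Finset.mem_univ c)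

end Pumps

end DWROCA

namespace DWROCA

/-! ### Runs with few configurations above a threshold -/

variable (M : DWROCA A S)

/-- The number of configurations with counter above `T` in a run, the last one not counted. -/
def high (T : ℕ) : M.Q × ℕ → List A → ℕ
  | _, [] => 0
  | c, x :: w => (if T < c.2 then 1 else 0) + high T (M.cstep c x) w

lemma high_append (T : ℕ) (c : M.Q × ℕ) (u v : List A) :
    M.high T c (u ++ v) = M.high T c u + M.high T (M.crun c u) v := by
  induction u generalizing c with
  | nil => simp [high]
  | cons x u ih => simp [high, ih, add_assoc]

lemma high_le_length (T : ℕ) (c : M.Q × ℕ) (w : List A) : M.high T c w ≤ w.length := by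
  induction w generalizing c with
  | nil => simp [high]
  | cons x w ih =>
    have := ih (M.cstep c x)
    simp only [high, List.length_cons]
    split_ifs <;> omega

lemma high_eq_zero {T : ℕ} {c : M.Q × ℕ} {w : List A}
    (h : ∀ i < w.length, (M.crun c (w.take i)).2 ≤ T) : M.high T c w = 0 := by
  induction w generalizing c with
  | nil => simp [high]
  | cons x w ih =>
    have h0 := h 0 (by simp)
    simp only [List.take_zero, crun_nil] at h0
    simp only [high, not_lt.2 h0, if_false, zero_add]
    exact ih fun i hi => by simpa using h (i + 1) (by simpa using hi)

lemma length_eq_high_add (T : ℕ) (c : M.Q × ℕ) (w : List A) :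
    w.length = M.high T c w +
      ((Finset.range w.length).filter fun i => (M.crun c (w.take i)).2 ≤ T).card := by
  have key : M.high T c w =
      ∑ i ∈ Finset.range w.length, if T < (M.crun c (w.take i)).2 then 1 else 0 := by
    induction w generalizing c with
    | nil => simp [high]
    | cons x w ih =>
      rw [List.length_cons, Finset.sum_range_succ', high, ih, add_comm]
      simp only [List.take_succ_cons, crun_cons, List.take_zero, crun_nil]
      rfl
  rw [key, ← Finset.card_filter]
  have := Finset.card_filter_add_card_filter_not (s := Finset.range w.length)
    (fun i => T < (M.crun c (w.take i)).2)
  simpa using this.symm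

/-- There is a run from `x` to `z` with at most `N` configurations above `T`. -/
def Reach (T N : ℕ) (x z : M.Q × ℕ) : Prop := ∃ w, M.crun x w = z ∧ M.high T x w ≤ N

variable {M}

lemma Reach.trans {T a b : ℕ} {x y z : M.Q × ℕ} (h : M.Reach T a x y) (h' : M.Reach T b y z) :
    M.Reach T (a + b) x z := by
  obtain ⟨u, rfl, hu⟩ := h
  obtain ⟨v, rfl, hv⟩ := h'
  exact ⟨u ++ v, M.crun_append _ _ _, by rw [high_append]; omega⟩

lemma Reach.mono {T a b : ℕ} {x y : M.Q × ℕ} (h : M.Reach T a x y) (hab : a ≤ b) :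
    M.Reach T b x y := by
  obtain ⟨u, hu, hu'⟩ := h
  exact ⟨u, hu, hu'.trans hab⟩

lemma Reach.exists_short {T N : ℕ} {x z : M.Q × ℕ} (h : M.Reach T N x z) :
    ∃ w, M.crun x w = z ∧ w.length ≤ Fintype.card M.Q * (T + 1) + N := by
  obtain ⟨w, hw, hN⟩ := h
  induction hn : w.length using Nat.strong_induction_on generalizing w with
  | _ n ih =>
    by_cases hinj : ∃ i j, i < j ∧ j ≤ w.length ∧ M.crun x (w.take i) = M.crun x (w.take j)
    · obtain ⟨i, j, hij, hj, he⟩ := hinj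
      obtain ⟨u, v, y, e, hu, hv, hul, hvl⟩ := exists_split w hij hj
      rw [← hu, ← hv] at he
      refine ih (u ++ y).length ?_ (u ++ y) ?_ ?_ rfl
      · have hlen : w.length = u.length + v.length + y.length := by rw [e]; simp [add_assoc]
        simp; omega
      · rw [← hw, e, M.crun_append, M.crun_append _ (u ++ v), he]
      · rw [e, high_append, high_append, ← he] at hN
        rw [high_append]
        omega
    · push Not at hinj
      refine ⟨w, hw, ?_⟩
      rw [M.length_eq_high_add T x w]
      have hcard : ((Finset.range w.length).filter fun i => (M.crun x (w.take i)).2 ≤ T).card ≤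
          ((Finset.univ : Finset M.Q) ×ˢ Finset.range (T + 1)).card := by
        refine Finset.card_le_card_of_injOn (fun i => M.crun x (w.take i)) ?_ ?_
        · intro i hi
          simp only [Finset.coe_filter, Finset.mem_range, Set.mem_ofPred_eq] at hi
          simpa [Nat.lt_succ_iff] using hi.2
        · intro i hi j hj he
          simp only [Finset.coe_filter, Finset.mem_range, Set.mem_ofPred_eq] at hi hj
          rcases lt_trichotomy i j with h | h | h
          · exact absurd he (hinj i j h hj.1.le)
          · exact h
          · exact absurd he.symm (hinj j i h hi.1.le)
      rw [Finset.card_product, Finset.card_range, Finset.card_univ] at hcard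
      omega

variable (M)

lemma crun_take_snd_le (c : M.Q × ℕ) (w : List A) :
    ∀ i ≤ w.length, (M.crun c (w.take i)).2 ≤ c.2 + i := by
  induction w generalizing c with
  | nil => simp
  | cons x w ih =>
    intro i hi
    cases i with
    | zero => simp
    | succ i =>
      have h1 := ih (M.cstep c x) i (by simpa using hi)
      have h2 := M.cstep_snd_le c x
      simp only [List.take_succ_cons, crun_cons]
      omega

lemma crun_take_snd_le' (c : M.Q × ℕ) (w : List A) :
    ∀ i ≤ w.length, (M.crun c (w.take i)).2 + i ≤ (M.crun c w).2 + w.length := by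
  induction w generalizing c with
  | nil => simp
  | cons x w ih =>
    intro i hi
    have h2 := M.cstep_snd_le c x
    cases i with
    | zero =>
      have h1 := ih (M.cstep c x) 0 (by simp)
      simp only [List.take_zero, crun_nil, crun_cons, List.length_cons] at h1 ⊢
      omega
    | succ i =>
      have h1 := ih (M.cstep c x) i (by simpa using hi)
      simp only [List.take_succ_cons, crun_cons, List.length_cons] at h1 ⊢
      omega

lemma crun_take_succ_le (c : M.Q × ℕ) (w : List A) (i : ℕ) :
    (M.crun c (w.take (i + 1))).2 ≤ (M.crun c (w.take i)).2 + 1 ∧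
      (M.crun c (w.take i)).2 ≤ (M.crun c (w.take (i + 1))).2 + 1 := by
  rcases lt_or_ge i w.length with h | h
  · rw [← List.take_append_getElem h, M.crun_append]
    exact M.cstep_snd_le _ _
  · rw [List.take_of_length_le h, List.take_of_length_le (by omega)]
    omega

/-- The part of a run between two positions, while the counter is positive. -/
lemma crun_segment (c : M.Q × ℕ) (w : List A) {i j : ℕ} (hij : i ≤ j) (hj : j ≤ w.length)
    (hpos : ∀ l, i ≤ l → l < j → 1 ≤ (M.crun c (w.take l)).2) :
    (M.crun c (w.take j)).1 = M.st (M.crun c (w.take i)).1 ((w.take j).drop i) ∧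
      ((M.crun c (w.take j)).2 : ℤ) = (M.crun c (w.take i)).2 +
        M.ef (M.crun c (w.take i)).1 ((w.take j).drop i) := by
  have h : ∀ l, i ≤ l → l ≤ j → w.take l = w.take i ++ ((w.take j).drop i).take (l - i) := by
    intro l hl hlj
    rw [List.take_drop, List.take_take, show i + (l - i) = l by omega, min_eq_left hlj]
    conv_lhs => rw [← List.take_append_drop i (w.take l), List.take_take, min_eq_left hl]
  have hlen : ((w.take j).drop i).length = j - i := by simp; omega
  have e : M.crun c (w.take j) = M.crun (M.crun c (w.take i)) ((w.take j).drop i) := by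
    have h' := h j hij le_rfl
    rw [← hlen, List.take_length] at h'
    conv_lhs => rw [h', M.crun_append]
  rw [e]
  refine M.crun_of_pos _ _ fun l hl => ?_
  rw [hlen] at hl
  have := hpos (i + l) (by omega) (by omega)
  rwa [h (i + l) (by omega) (by omega), M.crun_append, Nat.add_sub_cancel_left] at this

end DWROCA

namespace DWROCA

/-! ### Excursions above a threshold -/

/-- A symbolic description of an excursion: climb by iterating the closed walk of the component
`c`, follow `word`, descend by iterating the closed walk of the component `d`. -/
structure VArc (M : DWROCA A S) where
  /-- component of the climbing walk -/
  c : M.Q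
  /-- component of the descending walk -/
  d : M.Q
  /-- counter value at the start -/
  h0 : ℕ
  /-- counter value at the end -/
  h1 : ℕ
  /-- the connecting walk -/
  word : List A

variable {M : DWROCA A S} (P : M.Pumps 1) (N : M.Pumps (-1)) (L : ℕ)

namespace VArc

/-- The configuration where the excursion starts. -/
def src (a : VArc M) : M.Q × ℕ := (P.base a.c, a.h0)

/-- The configuration where the excursion ends. -/
def dst (a : VArc M) : M.Q × ℕ := (N.base a.d, a.h1)

/-- The excursion can be realised, with endpoints close to the height `L`. -/
structure Valid (a : VArc M) : Prop where
  okc : P.ok a.c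
  okd : N.ok a.d
  st_eq : M.st (P.base a.c) a.word = N.base a.d
  modEq : (a.h0 : ℤ) + M.ef (P.base a.c) a.word ≡ a.h1 [ZMOD Nat.gcd (P.gain a.c) (N.gain a.d)]
  le_h0 : L ≤ a.h0 + Fintype.card M.Q
  h0_le : a.h0 ≤ L + 2 * Fintype.card M.Q
  le_h1 : L ≤ a.h1 + Fintype.card M.Q
  h1_le : a.h1 ≤ L + 2 * Fintype.card M.Q

end VArc

/-- A run presented as a sequence of excursions joined by runs of small height. -/
def VPath : M.Q × ℕ → List (VArc M) → M.Q × ℕ → Prop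
  | x, [], z => M.Reach (L + 2 * Fintype.card M.Q) 0 x z
  | x, a :: l, z => a.Valid P N L ∧ M.Reach (L + 2 * Fintype.card M.Q) 0 x (a.src P) ∧
      VPath (a.dst N) l z

variable {P N L}

lemma VArc.Valid.realize {a : VArc M} (ha : a.Valid P N L) (hL : 2 * Fintype.card M.Q + 1 ≤ L) :
    ∃ i j : ℕ, Nat.gcd (P.gain a.c) (N.gain a.d) * (i * P.gain a.c) ≤
        Nat.gcd (P.gain a.c) (N.gain a.d) * (a.word.length + 3 * Fintype.card M.Q) +
          P.gain a.c * N.gain a.d ∧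
      Nat.gcd (P.gain a.c) (N.gain a.d) * (j * N.gain a.d) ≤
        2 * (Nat.gcd (P.gain a.c) (N.gain a.d) * (a.word.length + 3 * Fintype.card M.Q)) +
          P.gain a.c * N.gain a.d ∧
      ∃ w : List A, w.length ≤ i * P.size a.c + a.word.length + j * N.size a.d ∧
        M.crun (a.src P) w = a.dst N := by
  obtain ⟨okc, okd, hst, hmod, b1, b2, b3, b4⟩ := ha
  have gA := P.gain_eq okc
  have gB := N.gain_eq okd
  have oA := P.one_le_gain okc
  have oB := N.one_le_gain okd
  have lA := P.len _ okc
  have lB := N.len _ okd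
  have sA := P.size_le a.c
  have sB := N.size_le a.d
  have hM := M.ef_le (P.base a.c) a.word
  have hM' := M.neg_le_ef (P.base a.c) a.word
  obtain ⟨i, hi1, hi2, hi3⟩ := exists_mul_modEq oA oB
    (e := a.h1 - (a.h0 + M.ef (P.base a.c) a.word)) hmod.dvd
    (a.word.length + 3 * Fintype.card M.Q)
  obtain ⟨j, hj⟩ := hi3
  set k := Fintype.card M.Q
  set α := P.gain a.c
  set β := N.gain a.d
  set μ := a.word.length
  have hi1' : (μ + 3 * k : ℤ) ≤ i * α := by exact_mod_cast hi1
  have hj0 : 0 ≤ j := by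
    by_contra! hneg
    have : (β : ℤ) * j < 0 := mul_neg_of_pos_of_neg (by omega) hneg
    omega
  obtain ⟨j, rfl⟩ := Int.eq_ofNat_of_zero_le hj0
  refine ⟨i, j, hi2, ?_, wpow (P.word a.c) i ++ a.word ++ wpow (N.word a.d) j, ?_, ?_⟩
  · have h1 : j * β ≤ i * α + (μ + 3 * k) := by
      zify
      have : (j : ℤ) * β = i * α - (a.h1 - (a.h0 + M.ef (P.base a.c) a.word)) := by
        rw [hj]; ring
      omega
    have h2 := Nat.mul_le_mul_left (Nat.gcd α β) h1
    rw [Nat.mul_add] at h2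
    omega
  · simp only [List.length_append, length_wpow]
    have := Nat.mul_le_mul_left i lA
    have := Nat.mul_le_mul_left j lB
    omega
  · have e1 : M.crun (P.base a.c, a.h0) (wpow (P.word a.c) i) = (P.base a.c, a.h0 + i * α) :=
      M.crun_wpow (P.closed _ okc) i _ _ (by omega) (by omega) (by
        push_cast
        rw [gA, one_mul])
    obtain ⟨y, hy⟩ : ∃ y : ℕ, (y : ℤ) = (a.h0 + i * α : ℕ) + M.ef (P.base a.c) a.word :=
      ⟨_, Int.toNat_of_nonneg (by push_cast; omega)⟩
    have e2 : M.crun (P.base a.c, a.h0 + i * α) a.word = (N.base a.d, y) := by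
      rw [← hst]
      exact M.crun_of_length_le _ _ _ _ (by omega) hy
    have e3 : M.crun (N.base a.d, y) (wpow (N.word a.d) j) = (N.base a.d, a.h1) :=
      M.crun_wpow (N.closed _ okd) j _ _ (by push_cast at hy; omega) (by omega) (by
        rw [hy]
        push_cast
        have : M.ef (N.base a.d) (N.word a.d) = -β := by linarith
        rw [this]
        linear_combination -hj)
    rw [VArc.src, VArc.dst, M.crun_append, M.crun_append, e1, e2, e3]

/-- A prefix of a symbolic path can be completed by another continuation. -/
lemma VPath.replace {x z : M.Q × ℕ} {l m : List (VArc M)} {a : VArc M}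
    (h : VPath P N L x (l ++ a :: m) z) :
    a.Valid P N L ∧ VPath P N L (a.dst N) m z ∧
      ∀ (a' : VArc M) (m' : List (VArc M)), a'.src P = a.src P → a'.Valid P N L →
        VPath P N L (a'.dst N) m' z → VPath P N L x (l ++ a' :: m') z := by
  induction l generalizing x with
  | nil => exact ⟨h.1, h.2.2, fun a' m' hs hv hp => ⟨hv, hs ▸ h.2.1, hp⟩⟩
  | cons b l ih =>
    obtain ⟨h1, h2, h3⟩ := ih h.2.2
    exact ⟨h1, h2, fun a' m' hs hv hp => ⟨h.1, h.2.1, h3 a' m' hs hv hp⟩⟩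

lemma Reach.vpath {x y z : M.Q × ℕ} {l : List (VArc M)}
    (h : M.Reach (L + 2 * Fintype.card M.Q) 0 x y) (h' : VPath P N L y l z) :
    VPath P N L x l z := by
  cases l with
  | nil => exact h.trans h'
  | cons a l => exact ⟨h'.1, h.trans h'.2.1, h'.2.2⟩

variable (P N)

/-- Every run between configurations of height at most `L` has a symbolic description. -/
lemma exists_vpath (hL : 2 * Fintype.card M.Q + 1 ≤ L) (x : M.Q × ℕ) (w : List A)
    (hx : x.2 ≤ L) (hz : (M.crun x w).2 ≤ L) : ∃ l, VPath P N L x l (M.crun x w) := by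
  induction hn : w.length using Nat.strong_induction_on generalizing x w with
  | _ n ih =>
    have hk : 1 ≤ Fintype.card M.Q := Fintype.card_pos_iff.2 ⟨x.1⟩
    set k := Fintype.card M.Q with hkdef
    set H : ℕ → ℕ := fun i => (M.crun x (w.take i)).2 with hH
    by_cases hlow : ∀ i, H i ≤ L + k
    · exact ⟨[], w, rfl, (M.high_eq_zero fun i _ => (hlow i).trans (by omega)).le⟩
    push Not at hlow
    have hstep : ∀ i, H (i + 1) ≤ H i + 1 ∧ H i ≤ H (i + 1) + 1 := M.crun_take_succ_le x w
    have hHend : ∀ i, w.length ≤ i → H i ≤ L := fun i hi => by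
      simp only [hH, List.take_of_length_le hi]; exact hz
    have hH0 : H 0 ≤ L := hx
    -- the first position above `L + k`
    obtain ⟨i0, hi0, hi0'⟩ : ∃ i0, L + k < H i0 ∧ ∀ i < i0, H i ≤ L + k := by
      classical
      exact ⟨Nat.find hlow, Nat.find_spec hlow, fun i hi => not_lt.1 (Nat.find_min hlow hi)⟩
    have hi0w : i0 < w.length := by
      by_contra! h
      have := hHend i0 h
      omega
    -- the last position before it at height `L`
    obtain ⟨i1, hi1, hi1L, hi1'⟩ : ∃ i1 < i0, H i1 ≤ L ∧ ∀ i, i1 < i → i ≤ i0 → L < H i := by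
      classical
      have h1 := Nat.findGreatest_spec (P := fun i => H i ≤ L) (Nat.zero_le i0) hH0
      refine ⟨Nat.findGreatest (fun i => H i ≤ L) i0, ?_, h1, fun i hi hi' => ?_⟩
      · refine lt_of_le_of_ne (Nat.findGreatest_le i0) fun h => ?_
        rw [h] at h1
        omega
      · exact not_le.1 (Nat.findGreatest_is_greatest (P := fun i => H i ≤ L) hi hi')
    -- the first position after it at height `L`
    obtain ⟨i2, hi2, hi2L, hi2'⟩ : ∃ i2, i0 ≤ i2 ∧ H i2 ≤ L ∧ ∀ i, i0 ≤ i → i < i2 → L < H i := by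
      classical
      have hex : ∃ i, i0 ≤ i ∧ H i ≤ L := ⟨w.length, hi0w.le, hHend _ le_rfl⟩
      refine ⟨Nat.find hex, (Nat.find_spec hex).1, (Nat.find_spec hex).2, fun i h h' => ?_⟩
      have := Nat.find_min hex h'
      push Not at this
      exact this h
    have hi02 : i0 < i2 := lt_of_le_of_ne hi2 fun h => by rw [h] at hi0; omega
    have hi2w : i2 ≤ w.length := by
      by_contra! h
      have := hi2' w.length hi0w.le h
      have := hHend w.length le_rfl
      omega
    -- the last position before that above `L + k`
    obtain ⟨i3, hi03, hi32, hi3, hi3'⟩ : ∃ i3, i0 ≤ i3 ∧ i3 < i2 ∧ L + k < H i3 ∧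
        ∀ i, i3 < i → i ≤ i2 → H i ≤ L + k := by
      classical
      have h1 := Nat.findGreatest_spec (P := fun i => L + k < H i) hi2 hi0
      refine ⟨Nat.findGreatest (fun i => L + k < H i) i2, Nat.le_findGreatest hi2 hi0, ?_, h1,
        fun i hi hi' => not_lt.1
          (Nat.findGreatest_is_greatest (P := fun i => L + k < H i) hi hi')⟩
      refine lt_of_le_of_ne (Nat.findGreatest_le i2) fun h => ?_
      rw [h] at h1
      omega
    have hmid : ∀ i, i1 ≤ i → i ≤ i2 → L ≤ H i := by
      intro i h h'
      rcases eq_or_lt_of_le h with rfl | h1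
      · have := hi1' (i1 + 1) (by omega) (by omega)
        have := hstep i1
        omega
      · rcases le_or_gt i i0 with h2 | h2
        · exact (hi1' i h1 h2).le
        · rcases eq_or_lt_of_le h' with rfl | h3
          · have := hi2' (i - 1) (by omega) (by omega)
            have := hstep (i - 1)
            rw [Nat.sub_add_cancel (by omega)] at this
            omega
          · exact (hi2' i h2.le h3).le
    have hseg : ∀ i j, i1 ≤ i → i ≤ j → j ≤ i2 →
        (M.crun x (w.take j)).1 = M.st (M.crun x (w.take i)).1 ((w.take j).drop i) ∧
        (H j : ℤ) = H i + M.ef (M.crun x (w.take i)).1 ((w.take j).drop i) := by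
      intro i j h h' h''
      refine M.crun_segment x w h' (h''.trans hi2w) fun l hl hl' => ?_
      have := hmid l (by omega) (by omega)
      simp only [hH] at this
      omega
    have hsub : ∀ i j l, i ≤ j → j ≤ w.length → i + l ≤ j →
        ((w.take j).drop i).take l = (w.take (i + l)).drop i := by
      intro i j l _ _ h
      rw [List.take_drop, List.take_take, min_eq_left h]
    have hi0le : H i0 ≤ L + k + 1 := by
      have h1 := hi0' (i0 - 1) (by omega)
      have h2 := hstep (i0 - 1)
      rw [Nat.sub_add_cancel (by omega)] at h2
      omega
    have hi3le : H i3 ≤ L + k + 1 := by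
      have h1 := hi3' (i3 + 1) (by omega) (by omega)
      have h2 := hstep i3
      omega
    -- a state with a positive closed walk on the way up
    obtain ⟨iu, hu1, hu2, v, hv, hvpos⟩ : ∃ iu, i1 ≤ iu ∧ iu ≤ i0 ∧ ∃ v,
        M.st (M.crun x (w.take iu)).1 v = (M.crun x (w.take iu)).1 ∧
        0 < 1 * M.ef (M.crun x (w.take iu)).1 v := by
      have h1 := hseg i1 i0 le_rfl hi1.le hi2
      obtain ⟨l, hl, v, -, hv, hv'⟩ := M.exists_loop_of_ef 1 (by simp) (M.crun x (w.take i1)).1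
        ((w.take i0).drop i1) (by omega)
      have hl' : l ≤ i0 - i1 := by
        rw [List.length_drop, List.length_take] at hl
        omega
      rw [hsub i1 i0 l hi1.le hi0w.le (by omega),
        ← (hseg i1 (i1 + l) le_rfl (by omega) (by omega)).1] at hv hv'
      exact ⟨i1 + l, by omega, by omega, v, hv, hv'⟩
    -- a state with a negative closed walk on the way down
    obtain ⟨iw, hw1, hw2, v', hv', hvneg⟩ : ∃ iw, i3 ≤ iw ∧ iw ≤ i2 ∧ ∃ v,
        M.st (M.crun x (w.take iw)).1 v = (M.crun x (w.take iw)).1 ∧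
        0 < (-1) * M.ef (M.crun x (w.take iw)).1 v := by
      have h1 := hseg i3 i2 (by omega) hi32.le le_rfl
      obtain ⟨l, hl, v, -, hv, hv'⟩ := M.exists_loop_of_ef (-1) (by simp)
        (M.crun x (w.take i3)).1 ((w.take i2).drop i3) (by omega)
      have hl' : l ≤ i2 - i3 := by
        rw [List.length_drop, List.length_take] at hl
        omega
      rw [hsub i3 i2 l hi32.le hi2w (by omega),
        ← (hseg i3 (i3 + l) (by omega) (by omega) (by omega)).1] at hv hv'
      exact ⟨i3 + l, by omega, by omega, v, hv, hv'⟩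
    have hHu : L ≤ H iu ∧ H iu ≤ L + k + 1 := by
      refine ⟨hmid _ hu1 (by omega), ?_⟩
      rcases eq_or_lt_of_le hu2 with rfl | h
      · exact hi0le
      · have := hi0' _ h
        omega
    have hHw : L ≤ H iw ∧ H iw ≤ L + k + 1 := by
      refine ⟨hmid _ (by omega) hw2, ?_⟩
      rcases eq_or_lt_of_le hw1 with rfl | h
      · exact hi3le
      · have := hi3' _ h hw2
        omega
    have hR := hseg iu iw hu1 (by omega) hw2
    have hxu : M.Reach (L + 2 * k) 0 x (M.crun x (w.take iu)) := by
      refine ⟨w.take iu, rfl, (M.high_eq_zero fun i hi => ?_).le⟩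
      have hi' : i < iu := by simp at hi; omega
      rw [List.take_take, min_eq_left hi'.le]
      have := hi0' i (by omega)
      simp only [hH] at this
      omega
    have hwz : M.Reach (L + 2 * k) 0 (M.crun x (w.take iw)) (M.crun x (w.take i2)) := by
      refine ⟨(w.take i2).drop iw, ?_, (M.high_eq_zero fun i hi => ?_).le⟩
      · rw [← M.crun_append]
        congr 1
        conv_rhs => rw [← List.take_append_drop iw (w.take i2), List.take_take,
          min_eq_left hw2]
      · have hi' : i < i2 - iw := by simp at hi; omega
        rw [hsub iw i2 i hw2 hi2w (by omega), ← M.crun_append]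
        have e : w.take iw ++ (w.take (iw + i)).drop iw = w.take (iw + i) := by
          conv_rhs => rw [← List.take_append_drop iw (w.take (iw + i)), List.take_take,
            min_eq_left (by omega)]
        rw [e]
        change H (iw + i) ≤ _
        rcases Nat.eq_zero_or_pos i with rfl | h
        · rw [add_zero]; omega
        · have := hi3' (iw + i) (by omega) (by omega)
          omega
    -- the remaining run
    obtain ⟨l, hl⟩ := ih (w.drop i2).length (by simp; omega) (M.crun x (w.take i2)) (w.drop i2)
      hi2L (by rwa [← M.crun_append, List.take_append_drop]) rfl
    rw [← M.crun_append, List.take_append_drop] at hl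
    -- the excursion
    set pu := M.crun x (w.take iu) with hpu
    set pw := M.crun x (w.take iw) with hpw
    obtain ⟨c, okc, ⟨a1, ha1⟩, a2, ha2⟩ := P.cover _ v hv hvpos
    obtain ⟨d, okd, ⟨b1, hb1⟩, b2, hb2⟩ := N.cover _ v' hv' hvneg
    obtain ⟨s, hs, hsl⟩ := M.exists_short pu.1 a1
    obtain ⟨t, ht, htl⟩ := M.exists_short (P.base c) a2
    obtain ⟨s', hs', hsl'⟩ := M.exists_short pw.1 b1
    obtain ⟨t', ht', htl'⟩ := M.exists_short (N.base d) b2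
    rw [ha1] at hs
    rw [ha2] at ht
    rw [hb1] at hs'
    rw [hb2] at ht'
    have hst : M.st pu.1 (s ++ t) = pu.1 := by rw [M.st_append, hs, ht]
    have hst' : M.st pw.1 (s' ++ t') = pw.1 := by rw [M.st_append, hs', ht']
    have bs := abs_le.1 (M.abs_ef_le pu.1 s)
    have bt' := abs_le.1 (M.abs_ef_le (N.base d) t')
    have hpu2 : pu.2 = H iu := rfl
    have hpw2 : pw.2 = H iw := rfl
    obtain ⟨h0, hh0⟩ : ∃ h0 : ℕ, (h0 : ℤ) = H iu + M.ef pu.1 s :=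
      ⟨_, Int.toNat_of_nonneg (by omega)⟩
    obtain ⟨h1, hh1⟩ : ∃ h1 : ℕ, (h1 : ℤ) = H iw - M.ef (N.base d) t' :=
      ⟨_, Int.toNat_of_nonneg (by omega)⟩
    have oA := P.one_le_gain okc
    have oB := N.one_le_gain okd
    refine ⟨⟨c, d, h0, h1, t ++ wpow (s ++ t) (P.gain c - 1) ++ (w.take iw).drop iu ++
      wpow (s' ++ t') (N.gain d - 1) ++ s'⟩ :: l, ⟨okc, okd, ?_, ?_, ?_, ?_, ?_, ?_⟩, ?_, ?_⟩
    · simp only [M.st_append, ht, M.st_wpow hst, ← hR.1, M.st_wpow hst', hs']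
    · simp only [M.ef_append, M.st_append, ht, M.st_wpow hst, ← hR.1, M.st_wpow hst', hs',
        M.ef_wpow hst, M.ef_wpow hst', hs]
      rw [hh0, hh1, Nat.cast_sub oA, Nat.cast_sub oB]
      refine Int.modEq_iff_dvd.2 ?_
      have d1 : ((Nat.gcd (P.gain c) (N.gain d) : ℕ) : ℤ) ∣ P.gain c :=
        Int.natCast_dvd_natCast.2 (Nat.gcd_dvd_left _ _)
      have d2 : ((Nat.gcd (P.gain c) (N.gain d) : ℕ) : ℤ) ∣ N.gain d :=
        Int.natCast_dvd_natCast.2 (Nat.gcd_dvd_right _ _)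
      obtain ⟨y, hy⟩ := dvd_add (d1.mul_right (-(M.ef pu.1 s + M.ef (P.base c) t)))
        (d2.mul_right (-(M.ef pw.1 s' + M.ef (N.base d) t')))
      refine ⟨y, ?_⟩
      push_cast
      linear_combination hy + hR.2
    · simp only; omega
    · simp only; omega
    · simp only; omega
    · simp only; omega
    · refine hxu.trans (a := 0) (b := 0) ⟨s, ?_, (M.high_eq_zero fun i hi => ?_).le⟩
      · rw [VArc.src, ← hs]
        exact M.crun_of_length_le pu.1 pu.2 h0 s (by omega) (by rw [hh0, hpu2])
      · have := M.crun_take_snd_le pu s i hi.le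
        omega
    · have e : M.crun (N.base d, h1) t' = pw := by
        rw [M.crun_of_length_le (N.base d) h1 pw.2 t' (by omega) (by omega), ht']
      refine Reach.vpath (y := pw) ⟨t', e, (M.high_eq_zero fun i hi => ?_).le⟩
        (Reach.vpath hwz hl)
      have := M.crun_take_snd_le' (N.base d, h1) t' i hi.le
      rw [e] at this
      simp only [VArc.dst]
      omega

end DWROCA

namespace DWROCA

/-! ### Counting -/

lemma sum_le_of_separated {ι Q : Type*} [LinearOrder ι] [Fintype Q] (F : Finset ι) (μ : ι → ℕ)
    (s : ι → ℕ → Q) (f : ι → ℕ → ℤ) (m : ℕ) (hm : 1 ≤ m)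
    (sep : ∀ i ∈ F, ∀ j ∈ F, ∀ p ≤ μ i, ∀ r ≤ μ j, (i < j ∨ i = j ∧ p < r) → s i p = s j r →
      ¬ f i p ≡ f j r [ZMOD m]) :
    ∑ i ∈ F, (μ i + 1) ≤ Fintype.card Q * m := by
  have : NeZero m := ⟨by omega⟩
  have hcard : (F.sigma fun i => Finset.range (μ i + 1)).card ≤
      (Finset.univ : Finset (Q × ZMod m)).card := by
    refine Finset.card_le_card_of_injOn (fun x => (s x.1 x.2, (f x.1 x.2 : ZMod m)))
      (fun _ _ => Finset.mem_coe.2 (Finset.mem_univ _)) ?_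
    rintro ⟨i, p⟩ hi ⟨j, r⟩ hj he
    simp only [Finset.coe_sigma, Set.mem_sigma_iff, Finset.mem_coe, Finset.mem_range,
      Nat.lt_succ_iff] at hi hj
    simp only [Prod.mk.injEq, ZMod.intCast_eq_intCast_iff] at he
    rcases lt_trichotomy i j with h | rfl | h
    · exact absurd he.2 (sep i hi.1 j hj.1 p hi.2 r hj.2 (Or.inl h) he.1)
    · rcases lt_trichotomy p r with h | rfl | h
      · exact absurd he.2 (sep i hi.1 i hj.1 p hi.2 r hj.2 (Or.inr ⟨rfl, h⟩) he.1)
      · rfl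
      · exact absurd he.2.symm (sep i hi.1 i hj.1 r hj.2 p hi.2 (Or.inr ⟨rfl, h⟩) he.1.symm)
    · exact absurd he.2.symm (sep j hj.1 i hi.1 r hj.2 p hi.2 (Or.inl h) he.1.symm)
  simpa [Finset.card_sigma] using hcard

lemma card_le_of_separated {ι : Type*} [LinearOrder ι] (F : Finset ι) (f : ι → ℤ) (m : ℕ)
    (hm : 1 ≤ m) (sep : ∀ i ∈ F, ∀ j ∈ F, i < j → ¬ f i ≡ f j [ZMOD m]) : F.card ≤ m := by
  have := sum_le_of_separated (Q := Unit) F (fun _ => 0) (fun _ _ => ()) (fun i _ => f i) m hm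
    (fun i hi j hj p hp r hr h _ => sep i hi j hj (by
      rcases h with h | ⟨_, h⟩
      · exact h
      · omega))
  simpa using this

lemma sum_le_of_fibers {ι Q : Type*} [Fintype ι] [Fintype Q] [DecidableEq Q] (c : ι → Q)
    (v s : Q → ℚ) (x : ι → ℚ) (hs : ∀ q, 0 ≤ s q)
    (h : ∀ i, v (c i) * ∑ j with c j = c i, x j ≤ s (c i)) :
    ∑ i, v (c i) * x i ≤ ∑ q, s q := by
  rw [← Finset.sum_fiberwise (s := Finset.univ) (g := c)]
  refine Finset.sum_le_sum fun q _ => ?_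
  rcases Finset.eq_empty_or_nonempty (Finset.univ.filter fun j => c j = q) with he | ⟨i, hi⟩
  · rw [he]; simpa using hs q
  · obtain rfl : c i = q := by simpa using hi
    refine le_trans (le_of_eq ?_) (h i)
    rw [Finset.mul_sum]
    refine Finset.sum_congr rfl fun j hj => ?_
    rw [(Finset.mem_filter.1 hj).2]

lemma le_div_add_div {g a b i X : ℕ} (hg : 1 ≤ g) (ha : 1 ≤ a) (h : g * (i * a) ≤ g * X + a * b) :
    (i : ℚ) ≤ X / a + b / g := by
  have hg' : (0 : ℚ) < g := by exact_mod_cast hg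
  have ha' : (0 : ℚ) < a := by exact_mod_cast ha
  have h' : (g : ℚ) * (i * a) ≤ g * X + a * b := by exact_mod_cast h
  rw [div_add_div _ _ ha'.ne' hg'.ne', le_div_iff₀ (by positivity)]
  linarith

/-- The total length of a family of excursions of which no two can be merged. -/
lemma sum_length_le {ι Q : Type*} [Fintype ι] [Fintype Q] [DecidableEq Q] (c d : ι → Q)
    (a b sa sb : Q → ℕ) (μ I J : ι → ℕ) (k : ℕ)
    (ha : ∀ i, 1 ≤ a (c i)) (hb : ∀ i, 1 ≤ b (d i))
    (has : ∀ i, a (c i) ≤ sa (c i)) (hbs : ∀ i, b (d i) ≤ sb (d i))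
    (hsa : ∑ q, sa q = k) (hsb : ∑ q, sb q = k)
    (n1 : ∀ i, ∑ j with c j = c i, (μ j + 1) ≤ k * a (c i))
    (n2 : ∀ i, (Finset.univ.filter fun j => c j = c i).card ≤ a (c i))
    (n3 : ∀ i, ∑ j with d j = d i, (μ j + 1) ≤ k * b (d i))
    (n4 : ∀ i, (Finset.univ.filter fun j => d j = d i).card ≤ b (d i))
    (n5 : ∀ i, (Finset.univ.filter fun j => (c j, d j) = (c i, d i)).card ≤
      Nat.gcd (a (c i)) (b (d i)))
    (hI : ∀ i, Nat.gcd (a (c i)) (b (d i)) * (I i * a (c i)) ≤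
      Nat.gcd (a (c i)) (b (d i)) * (μ i + 3 * k) + a (c i) * b (d i))
    (hJ : ∀ i, Nat.gcd (a (c i)) (b (d i)) * (J i * b (d i)) ≤
      2 * (Nat.gcd (a (c i)) (b (d i)) * (μ i + 3 * k)) + a (c i) * b (d i)) :
    ∑ i, (I i * sa (c i) + μ i + J i * sb (d i)) ≤ 15 * k ^ 2 := by
  have hg : ∀ i, 1 ≤ Nat.gcd (a (c i)) (b (d i)) := fun i => Nat.gcd_pos_of_pos_left _ (ha i)
  have qa : ∀ i, (0 : ℚ) < a (c i) := fun i => by exact_mod_cast ha i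
  have qb : ∀ i, (0 : ℚ) < b (d i) := fun i => by exact_mod_cast hb i
  have qg : ∀ i, (0 : ℚ) < Nat.gcd (a (c i)) (b (d i)) := fun i => by exact_mod_cast hg i
  have qsa : ∑ q, (sa q : ℚ) = k := by exact_mod_cast hsa
  have qsb : ∑ q, (sb q : ℚ) = k := by exact_mod_cast hsb
  have m1 : ∀ i, ∑ j with c j = c i, (μ j : ℚ) ≤ k * a (c i) := fun i => by
    have h := n1 i
    rw [Finset.sum_add_distrib] at h
    exact_mod_cast le_of_add_le_left h
  have m3 : ∀ i, ∑ j with d j = d i, (μ j : ℚ) ≤ k * b (d i) := fun i => by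
    have h := n3 i
    rw [Finset.sum_add_distrib] at h
    exact_mod_cast le_of_add_le_left h
  have t1 : ∑ i, (sa (c i) / a (c i) : ℚ) * μ i ≤ ∑ q, (sa q : ℚ) * k :=
    sum_le_of_fibers c (fun q => (sa q / a q : ℚ)) _ _ (fun q => by positivity) fun i => by
      refine (mul_le_mul_of_nonneg_left (m1 i) (by positivity)).trans (le_of_eq ?_)
      field_simp [(qa i).ne']
  have t2 : ∑ i, (sa (c i) / a (c i) : ℚ) * 1 ≤ ∑ q, (sa q : ℚ) :=
    sum_le_of_fibers c (fun q => (sa q / a q : ℚ)) _ _ (fun q => by positivity) fun i => by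
      have h : (∑ j with c j = c i, (1 : ℚ)) ≤ a (c i) := by simpa using n2 i
      refine (mul_le_mul_of_nonneg_left h (by positivity)).trans (le_of_eq ?_)
      field_simp [(qa i).ne']
  have t3 : ∑ i, (sb (d i) / b (d i) : ℚ) * μ i ≤ ∑ q, (sb q : ℚ) * k :=
    sum_le_of_fibers d (fun q => (sb q / b q : ℚ)) _ _ (fun q => by positivity) fun i => by
      refine (mul_le_mul_of_nonneg_left (m3 i) (by positivity)).trans (le_of_eq ?_)
      field_simp [(qb i).ne']
  have t4 : ∑ i, (sb (d i) / b (d i) : ℚ) * 1 ≤ ∑ q, (sb q : ℚ) :=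
    sum_le_of_fibers d (fun q => (sb q / b q : ℚ)) _ _ (fun q => by positivity) fun i => by
      have h : (∑ j with d j = d i, (1 : ℚ)) ≤ b (d i) := by simpa using n4 i
      refine (mul_le_mul_of_nonneg_left h (by positivity)).trans (le_of_eq ?_)
      field_simp [(qb i).ne']
  have t5 : ∑ i, (1 : ℚ) * μ i ≤ ∑ q, (sa q : ℚ) * k :=
    sum_le_of_fibers c (fun _ => (1 : ℚ)) _ _ (fun q => by positivity) fun i => by
      have h : (a (c i) : ℚ) ≤ sa (c i) := by exact_mod_cast has i
      rw [one_mul]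
      refine (m1 i).trans ?_
      rw [mul_comm]
      exact mul_le_mul_of_nonneg_right h (by positivity)
  have hcount : ∀ i, (∑ j with (c j, d j) = (c i, d i), (1 : ℚ)) ≤
      Nat.gcd (a (c i)) (b (d i)) := fun i => by
    have := n5 i
    rw [Finset.sum_const, nsmul_eq_mul, mul_one]
    exact_mod_cast this
  have t6 : ∑ i, (sa (c i) * b (d i) / Nat.gcd (a (c i)) (b (d i)) : ℚ) * 1 ≤
      ∑ q : Q × Q, (sa q.1 * sb q.2 : ℚ) :=
    sum_le_of_fibers (fun i => (c i, d i))
      (fun q => (sa q.1 * b q.2 / Nat.gcd (a q.1) (b q.2) : ℚ)) _ _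
      (fun q => by positivity) fun i => by
      refine (mul_le_mul_of_nonneg_left (hcount i) (by positivity)).trans ?_
      have h : (b (d i) : ℚ) ≤ sb (d i) := by exact_mod_cast hbs i
      simp only
      rw [div_mul_cancel₀ _ (qg i).ne']
      exact mul_le_mul_of_nonneg_left h (by positivity)
  have t7 : ∑ i, (sb (d i) * a (c i) / Nat.gcd (a (c i)) (b (d i)) : ℚ) * 1 ≤
      ∑ q : Q × Q, (sa q.1 * sb q.2 : ℚ) :=
    sum_le_of_fibers (fun i => (c i, d i))
      (fun q => (sb q.2 * a q.1 / Nat.gcd (a q.1) (b q.2) : ℚ)) _ _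
      (fun q => by positivity) fun i => by
      refine (mul_le_mul_of_nonneg_left (hcount i) (by positivity)).trans ?_
      have h : (a (c i) : ℚ) ≤ sa (c i) := by exact_mod_cast has i
      simp only
      rw [div_mul_cancel₀ _ (qg i).ne', mul_comm]
      exact mul_le_mul_of_nonneg_right h (by positivity)
  have hprod : ∑ q : Q × Q, (sa q.1 * sb q.2 : ℚ) = k * k := by
    simp only [Fintype.sum_prod_type]
    rw [← Finset.sum_mul_sum, qsa, qsb]
  rw [hprod] at t6 t7
  rw [← Finset.sum_mul, qsa] at t1 t5
  rw [← Finset.sum_mul, qsb] at t3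
  rw [qsa] at t2
  rw [qsb] at t4
  have key : ∑ i, ((I i * sa (c i) + μ i + J i * sb (d i) : ℕ) : ℚ) ≤
      ∑ i, ((sa (c i) / a (c i) : ℚ) * μ i + 3 * k * ((sa (c i) / a (c i) : ℚ) * 1) +
        (sa (c i) * b (d i) / Nat.gcd (a (c i)) (b (d i)) : ℚ) * 1 + 1 * μ i +
        2 * ((sb (d i) / b (d i) : ℚ) * μ i) + 6 * k * ((sb (d i) / b (d i) : ℚ) * 1) +
        (sb (d i) * a (c i) / Nat.gcd (a (c i)) (b (d i)) : ℚ) * 1) := by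
    refine Finset.sum_le_sum fun i _ => ?_
    have h1 := le_div_add_div (hg i) (ha i) (hI i)
    have h2 : (J i : ℚ) ≤ (2 * (μ i + 3 * k) : ℕ) / b (d i) +
        a (c i) / Nat.gcd (a (c i)) (b (d i)) :=
      le_div_add_div (hg i) (hb i) ((hJ i).trans (le_of_eq (by ring)))
    have h1' := mul_le_mul_of_nonneg_right h1 (Nat.cast_nonneg (α := ℚ) (sa (c i)))
    have h2' := mul_le_mul_of_nonneg_right h2 (Nat.cast_nonneg (α := ℚ) (sb (d i)))
    push_cast at h1' h2' ⊢
    refine (add_le_add (add_le_add_left h1' _) h2').trans (le_of_eq ?_)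
    ring
  simp only [Finset.sum_add_distrib, ← Finset.mul_sum] at key t1 t2 t3 t4 t5 t6 t7
  have hk0 : (0 : ℚ) ≤ k := by positivity
  have t2' := mul_le_mul_of_nonneg_left t2 hk0
  have t4' := mul_le_mul_of_nonneg_left t4 hk0
  have : ((∑ i, (I i * sa (c i) + μ i + J i * sb (d i)) : ℕ) : ℚ) ≤ (15 * k ^ 2 : ℕ) := by
    push_cast at key ⊢
    simp only [Finset.sum_add_distrib] at key ⊢
    nlinarith
  exact_mod_cast this

end DWROCA

namespace DWROCA

/-! ### Short runs between configurations of bounded height -/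

variable {M : DWROCA A S} (P : M.Pumps 1) (N : M.Pumps (-1)) {L : ℕ}

namespace VArc

/-- The state after `p` letters of the connecting walk. -/
def pst (a : VArc M) (p : ℕ) : M.Q := M.st (P.base a.c) (a.word.take p)

/-- The counter value after `p` letters, measured from the start. -/
def fwd (a : VArc M) (p : ℕ) : ℤ := a.h0 + M.ef (P.base a.c) (a.word.take p)

/-- The counter value after `p` letters, measured from the end. -/
def back (a : VArc M) (p : ℕ) : ℤ := a.h1 - M.ef (a.pst P p) (a.word.drop p)

/-- Follow `a` for `p` letters, then `b` from its letter `r`. -/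
def merge (a b : VArc M) (p r : ℕ) : VArc M :=
  ⟨a.c, b.d, a.h0, b.h1, a.word.take p ++ b.word.drop r⟩

variable {P N}

lemma Valid.merge {a b : VArc M} (ha : a.Valid P N L) (hb : b.Valid P N L) {p r : ℕ}
    (hs : a.pst P p = b.pst P r)
    (h : a.fwd P p ≡ b.back P r [ZMOD Nat.gcd (P.gain a.c) (N.gain b.d)]) :
    (a.merge b p r).Valid P N L := by
  have hs' : M.st (P.base a.c) (a.word.take p) = M.st (P.base b.c) (b.word.take r) := hs
  refine ⟨ha.okc, hb.okd, ?_, ?_, ha.le_h0, ha.h0_le, hb.le_h1, hb.h1_le⟩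
  · simp only [VArc.merge, M.st_append]
    rw [hs', ← M.st_append, List.take_append_drop, hb.st_eq]
  · have h2 := h.add_right (M.ef (M.st (P.base b.c) (b.word.take r)) (b.word.drop r))
    simp only [VArc.fwd, VArc.back, VArc.pst, sub_add_cancel] at h2
    simp only [VArc.merge, M.ef_append, hs', ← add_assoc]
    exact h2

lemma Valid.fwd_modEq_back {a : VArc M} (ha : a.Valid P N L) (p : ℕ) :
    a.fwd P p ≡ a.back P p [ZMOD Nat.gcd (P.gain a.c) (N.gain a.d)] := by
  have h := ha.modEq
  rw [← List.take_append_drop p a.word, M.ef_append] at h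
  have h2 := h.add_right (-M.ef (a.pst P p) (a.word.drop p))
  simp only [VArc.fwd, VArc.back, VArc.pst] at h2 ⊢
  convert h2 using 1 <;> ring

end VArc

variable {P N}

/-- The size of a symbolic path. -/
def vsize (l : List (VArc M)) : ℕ := (l.map fun a => a.word.length + 1).sum

lemma VPath.valid {x z : M.Q × ℕ} {l : List (VArc M)} (h : VPath P N L x l z) :
    ∀ a ∈ l, a.Valid P N L := by
  intro a ha
  obtain ⟨l₁, l₂, rfl⟩ := List.append_of_mem ha
  exact h.replace.1

lemma VPath.reach {x z : M.Q × ℕ} {l : List (VArc M)} (h : VPath P N L x l z) (f : VArc M → ℕ)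
    (hf : ∀ a ∈ l, ∃ w : List A, w.length ≤ f a ∧ M.crun (a.src P) w = a.dst N) :
    M.Reach (L + 2 * Fintype.card M.Q) (l.map f).sum x z := by
  induction l generalizing x with
  | nil => exact h
  | cons a l ih =>
    obtain ⟨w, hw, hw'⟩ := hf a (by simp)
    have h1 := ih h.2.2 fun b hb => hf b (by simp [hb])
    have h2 : M.Reach (L + 2 * Fintype.card M.Q) (f a) (a.src P) (a.dst N) :=
      ⟨w, hw', (M.high_le_length _ _ _).trans hw⟩
    exact ((h.2.1.trans h2).trans h1).mono (by simp)

lemma exists_eq_append_getElem {T : Type*} (l : List T) {i j : ℕ} (hij : i < j)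
    (hj : j < l.length) :
    ∃ l₁ l₂ l₃, l = l₁ ++ l[i] :: (l₂ ++ l[j] :: l₃) := by
  have e1 : l = l.take i ++ l[i] :: l.drop (i + 1) := by
    rw [← List.drop_eq_getElem_cons, List.take_append_drop]
  have e2 : l.drop (i + 1) =
      (l.drop (i + 1)).take (j - (i + 1)) ++ l[j] :: l.drop (j + 1) := by
    conv_lhs => rw [← List.take_append_drop (j - (i + 1)) (l.drop (i + 1)), List.drop_drop,
      show i + 1 + (j - (i + 1)) = j by omega, List.drop_eq_getElem_cons hj]
  exact ⟨_, _, _, e1.trans (by rw [← e2])⟩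

/-- In a symbolic path of minimal size no two excursions can be merged. -/
lemma VPath.exists_reduced {x z : M.Q × ℕ} {l₀ : List (VArc M)} (h : VPath P N L x l₀ z) :
    ∃ l, VPath P N L x l z ∧ ∀ (i j : Fin l.length) (p r : ℕ), p ≤ l[i].word.length →
      r ≤ l[j].word.length → (i < j ∨ i = j ∧ p < r) → l[i].pst P p = l[j].pst P r →
      ¬ l[i].fwd P p ≡ l[j].back P r [ZMOD Nat.gcd (P.gain l[i].c) (N.gain l[j].d)] := by
  classical
  have hex : ∃ n l, VPath P N L x l z ∧ vsize l = n := ⟨_, l₀, h, rfl⟩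
  obtain ⟨l, hl, hn⟩ := Nat.find_spec hex
  have hmin : ∀ l', VPath P N L x l' z → vsize l ≤ vsize l' := fun l' h' =>
    hn.trans_le (Nat.find_min' hex ⟨l', h', rfl⟩)
  refine ⟨l, hl, fun i j p r hp hr hlt hs hmod => ?_⟩
  have hvi : l[i].Valid P N L := hl.valid _ (List.getElem_mem _)
  have hvj : l[j].Valid P N L := hl.valid _ (List.getElem_mem _)
  have hm := hvi.merge hvj hs hmod
  rcases hlt with hij | ⟨rfl, hpr⟩
  · obtain ⟨l₁, l₂, l₃, e⟩ := exists_eq_append_getElem l hij j.2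
    change l = l₁ ++ l[i] :: (l₂ ++ l[j] :: l₃) at e
    generalize l[i] = a at *
    generalize l[j] = b at *
    have hl' := hl
    rw [e] at hl'
    obtain ⟨-, h1, h2⟩ := hl'.replace
    have h3 := hmin _ (h2 (a.merge b p r) l₃ rfl hm h1.replace.2.1)
    rw [e] at h3
    simp only [vsize, List.map_append, List.map_cons, List.sum_append, List.sum_cons, VArc.merge,
      List.length_append, List.length_take, List.length_drop] at h3
    omega
  · have e : l = l.take i ++ l[i] :: l.drop (i + 1) := by
      rw [Fin.getElem_fin, ← List.drop_eq_getElem_cons, List.take_append_drop]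
    generalize l.take i = l₁ at *
    generalize l.drop (i + 1) = l₃ at *
    generalize l[i] = a at *
    have hl' := hl
    rw [e] at hl'
    obtain ⟨-, h1, h2⟩ := hl'.replace
    have h3 := hmin _ (h2 (a.merge a p r) l₃ rfl hm h1)
    rw [e] at h3
    simp only [vsize, List.map_append, List.map_cons, List.sum_append, List.sum_cons, VArc.merge,
      List.length_append, List.length_take, List.length_drop] at h3
    omega

variable (M)

/-- Configurations of height at most `L` that are connected by some run are connected by a
short one. -/
theorem exists_short_crun (hL : 2 * Fintype.card M.Q + 1 ≤ L) (x : M.Q × ℕ) (w : List A)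
    (hx : x.2 ≤ L) (hz : (M.crun x w).2 ≤ L) :
    ∃ w', M.crun x w' = M.crun x w ∧
      w'.length ≤ Fintype.card M.Q * (L + 2 * Fintype.card M.Q + 1) +
        15 * Fintype.card M.Q ^ 2 := by
  classical
  obtain ⟨P⟩ := M.nonempty_pumps 1
  obtain ⟨N⟩ := M.nonempty_pumps (-1)
  obtain ⟨l₀, hl₀⟩ := exists_vpath P N hL x w hx hz
  obtain ⟨l, hl, hsep⟩ := hl₀.exists_reduced
  have hreal : ∀ a : VArc M, a.Valid P N L → _ := fun a ha => ha.realize hL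
  choose! I J hI hJ W hW hW' using hreal
  have hv : ∀ i : Fin l.length, l[i].Valid P N L := fun i => hl.valid _ (List.getElem_mem _)
  have hr := hl.reach (fun a => I a * P.size a.c + a.word.length + J a * N.size a.d)
    fun a ha => ⟨W a, hW a (hl.valid a ha), hW' a (hl.valid a ha)⟩
  refine (hr.mono ?_).exists_short
  rw [← Fin.sum_univ_fun_getElem]
  have same : ∀ (i : Fin l.length) (p : ℕ), l[i].fwd P p ≡ l[i].back P p
      [ZMOD Nat.gcd (P.gain l[i].c) (N.gain l[i].d)] := fun i p => (hv i).fwd_modEq_back p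
  have sepc : ∀ i j : Fin l.length, l[i].c = l[j].c → ∀ p ≤ l[i].word.length,
      ∀ r ≤ l[j].word.length, (i < j ∨ i = j ∧ p < r) → l[i].pst P p = l[j].pst P r →
      ¬ l[i].fwd P p ≡ l[j].fwd P r [ZMOD Nat.gcd (P.gain l[i].c) (N.gain l[j].d)] := by
    intro i j hc p hp r hr hlt hs hmod
    refine hsep i j p r hp hr hlt hs (hmod.trans ?_)
    rw [hc]
    exact same j r
  have sepd : ∀ i j : Fin l.length, l[i].d = l[j].d → ∀ p ≤ l[i].word.length,
      ∀ r ≤ l[j].word.length, (i < j ∨ i = j ∧ p < r) → l[i].pst P p = l[j].pst P r →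
      ¬ l[i].back P p ≡ l[j].back P r [ZMOD N.gain l[j].d] := by
    intro i j hd p hp r hr hlt hs hmod
    refine hsep i j p r hp hr hlt hs (Int.ModEq.trans ?_
      (hmod.of_dvd (Int.natCast_dvd_natCast.2 (Nat.gcd_dvd_right _ _))))
    rw [← hd]
    exact same i p
  refine sum_length_le (fun i : Fin l.length => l[i].c) (fun i : Fin l.length => l[i].d)
    P.gain N.gain P.size N.size (fun i : Fin l.length => l[i].word.length)
    (fun i : Fin l.length => I l[i]) (fun i : Fin l.length => J l[i]) (Fintype.card M.Q)
    (fun i => P.one_le_gain (hv i).okc) (fun i => N.one_le_gain (hv i).okd)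
    (fun i => (P.gain_le_length (by simp) (hv i).okc).trans (P.len _ (hv i).okc))
    (fun i => (N.gain_le_length (by simp) (hv i).okd).trans (N.len _ (hv i).okd))
    P.sum_size N.sum_size ?_ ?_ ?_ ?_ ?_ (fun i => hI _ (hv i)) (fun i => hJ _ (hv i))
  · intro q
    refine sum_le_of_separated _ _ (fun i => l[i].pst P) (fun i => l[i].fwd P) _
      (P.one_le_gain (hv q).okc) fun i hi j hj p hp r hr hlt hs hmod => ?_
    have hi' := (Finset.mem_filter.1 hi).2
    have hj' := (Finset.mem_filter.1 hj).2
    refine sepc i j (hi'.trans hj'.symm) p hp r hr hlt hs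
      (hmod.of_dvd (Int.natCast_dvd_natCast.2 ?_))
    rw [hi']
    exact Nat.gcd_dvd_left _ _
  · intro q
    refine card_le_of_separated _ (fun i => l[i].fwd P 0) _
      (P.one_le_gain (hv q).okc) fun i hi j hj hlt hmod => ?_
    have hi' := (Finset.mem_filter.1 hi).2
    have hj' := (Finset.mem_filter.1 hj).2
    refine sepc i j (hi'.trans hj'.symm) 0 (Nat.zero_le _) 0 (Nat.zero_le _) (Or.inl hlt) ?_
      (hmod.of_dvd (Int.natCast_dvd_natCast.2 ?_))
    · simp only [VArc.pst, List.take_zero, st_nil]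
      rw [hi', hj']
    · rw [hi']
      exact Nat.gcd_dvd_left _ _
  · intro q
    refine sum_le_of_separated _ _ (fun i => l[i].pst P) (fun i => l[i].back P) _
      (N.one_le_gain (hv q).okd) fun i hi j hj p hp r hr hlt hs hmod => ?_
    have hi' := (Finset.mem_filter.1 hi).2
    have hj' := (Finset.mem_filter.1 hj).2
    refine sepd i j (hi'.trans hj'.symm) p hp r hr hlt hs ?_
    rw [hj']
    exact hmod
  · intro q
    refine card_le_of_separated _ (fun i => l[i].back P l[i].word.length) _
      (N.one_le_gain (hv q).okd) fun i hi j hj hlt hmod => ?_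
    have hi' := (Finset.mem_filter.1 hi).2
    have hj' := (Finset.mem_filter.1 hj).2
    refine sepd i j (hi'.trans hj'.symm) _ le_rfl _ le_rfl (Or.inl hlt) ?_ ?_
    · simp only [VArc.pst, List.take_length]
      rw [(hv i).st_eq, (hv j).st_eq, hi', hj']
    · rw [hj']
      exact hmod
  · intro q
    refine card_le_of_separated _ (fun i => l[i].fwd P 0) _
      (Nat.gcd_pos_of_pos_left _ (P.one_le_gain (hv q).okc)) fun i hi j hj hlt hmod => ?_
    have hi' := Prod.mk.inj (Finset.mem_filter.1 hi).2
    have hj' := Prod.mk.inj (Finset.mem_filter.1 hj).2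
    refine sepc i j (hi'.1.trans hj'.1.symm) 0 (Nat.zero_le _) 0 (Nat.zero_le _) (Or.inl hlt) ?_ ?_
    · simp only [VArc.pst, List.take_zero, st_nil]
      rw [hi'.1, hj'.1]
    · rw [hi'.1, hj'.2]
      exact hmod

end DWROCA

namespace DWROCA

/-! ### The rate of descent of a shortest run -/

variable (M : DWROCA A S)

/-- A visited descending closed walk with the best ratio of length to descent, which bounds
the length of the walk from below. -/
lemma exists_best_loop (q : M.Q) (w v : List A) (hv : v.length ≤ Fintype.card M.Q)
    (hcl : M.st (M.st q w) v = M.st q w) (hneg : M.ef (M.st q w) v < 0) :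
    ∃ (i : ℕ) (s : List A) (b : ℕ), s.length ≤ Fintype.card M.Q ∧
      M.st (M.st q (w.take i)) s = M.st q (w.take i) ∧ 1 ≤ b ∧
      M.ef (M.st q (w.take i)) s = -b ∧
      -(s.length * M.ef q w) ≤ b * w.length + s.length * Fintype.card M.Q := by
  classical
  set k := Fintype.card M.Q
  let good : ℕ × ℕ → Prop := fun x => ∃ (i : ℕ) (s : List A), s.length = x.1 ∧
    M.st (M.st q (w.take i)) s = M.st q (w.take i) ∧ M.ef (M.st q (w.take i)) s = -(x.2 : ℤ)
  let F := ((Finset.Icc 1 k) ×ˢ (Finset.Icc 1 k)).filter good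
  have hgood : ∀ (i : ℕ) (s : List A), s.length ≤ k →
      M.st (M.st q (w.take i)) s = M.st q (w.take i) → M.ef (M.st q (w.take i)) s < 0 →
      (s.length, (-M.ef (M.st q (w.take i)) s).toNat) ∈ F := by
    intro i s h1 h2 h3
    have h4 := M.neg_le_ef (M.st q (w.take i)) s
    refine Finset.mem_filter.2 ⟨?_, i, s, rfl, h2, ?_⟩
    · simp only [Finset.mem_product, Finset.mem_Icc]
      omega
    · simp only
      omega
  have hne : F.Nonempty := ⟨_, hgood w.length v hv (by simpa using hcl) (by simpa using hneg)⟩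
  obtain ⟨⟨a, b⟩, hab, hmin⟩ := F.exists_min_image (fun x => (x.1 : ℚ) / x.2) hne
  obtain ⟨hab1, i, s, hs, hscl, hsef⟩ := Finset.mem_filter.1 hab
  simp only [Finset.mem_product, Finset.mem_Icc] at hab1 hs hsef
  subst hs
  refine ⟨i, s, b, by omega, hscl, by omega, hsef, ?_⟩
  have hloops : ∀ j u, u.length ≤ k → M.st (M.st q (w.take j)) u = M.st q (w.take j) →
      (-(s.length : ℤ)) * M.ef (M.st q (w.take j)) u - b * u.length ≤ 0 := by
    intro j u hu hucl
    rcases le_or_gt 0 (M.ef (M.st q (w.take j)) u) with h | h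
    · have h1 : (0 : ℤ) ≤ s.length * M.ef (M.st q (w.take j)) u := by positivity
      have h2 : (0 : ℤ) ≤ b * u.length := by positivity
      linarith
    · have h1 := hmin _ (hgood j u hu hucl h)
      obtain ⟨e, he⟩ : ∃ e : ℕ, (-M.ef (M.st q (w.take j)) u).toNat = e := ⟨_, rfl⟩
      have he0 : 1 ≤ e := by omega
      have he' : M.ef (M.st q (w.take j)) u = -e := by omega
      simp only [he] at h1
      rw [div_le_div_iff₀ (by exact_mod_cast hab1.2.1) (by exact_mod_cast he0)] at h1
      have h2 : (s.length : ℤ) * e ≤ u.length * b := by exact_mod_cast h1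
      rw [he']
      linarith
  obtain ⟨w', -, h2, h3⟩ := M.exists_short_of_loops _ _ q w hloops
  have h4 := M.neg_le_ef q w'
  have h5 : (s.length : ℤ) * (-M.ef q w') ≤ s.length * k :=
    mul_le_mul_of_nonneg_left (by omega) (by positivity)
  have h6 : (0 : ℤ) ≤ b * w'.length := by positivity
  linarith

/-- A walk down from a large counter value, rebuilt so as to use mostly one descending
closed walk. -/
lemma exists_descent (q : M.Q) (m h : ℕ) (w s v : List A) (i a b : ℕ)
    (hs : s.length ≤ Fintype.card M.Q) (hsa : s.length = a)
    (hscl : M.st (M.st q (w.take i)) s = M.st q (w.take i)) (hb : 1 ≤ b)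
    (hsb : M.ef (M.st q (w.take i)) s = -b)
    (hv : v.length ≤ Fintype.card M.Q) (hvcl : M.st (M.st q w) v = M.st q w)
    (hneg : M.ef (M.st q w) v < 0) (hh : (h : ℤ) = m + M.ef q w)
    (hhk : Fintype.card M.Q ≤ h) (hm : 5 * Fintype.card M.Q ^ 2 + h ≤ m) :
    ∃ w', M.crun (q, m) w' = (M.st q w, h) ∧
      b * w'.length ≤ a * m + 7 * Fintype.card M.Q ^ 2 * b := by
  obtain ⟨β, hβ⟩ : ∃ β : ℕ, (β : ℤ) = -M.ef (M.st q w) v := ⟨_, Int.toNat_of_nonneg (by omega)⟩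
  have hβ1 : 1 ≤ β := by omega
  have hβk : β ≤ Fintype.card M.Q := by
    have := M.neg_le_ef (M.st q w) v
    omega
  have hbk : b ≤ Fintype.card M.Q := by
    have := M.neg_le_ef (M.st q (w.take i)) s
    omega
  set k := Fintype.card M.Q
  set g := Nat.gcd β b with hg
  have hg1 : 1 ≤ g := Nat.gcd_pos_of_pos_left _ hβ1
  have hgβ : g ≤ β := Nat.gcd_le_left _ hβ1
  have hgb : g ≤ b := Nat.gcd_le_right _ hb
  obtain ⟨r, hr1, hr2, hr3⟩ := M.exists_short_mod q (w.take i) hg1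
  obtain ⟨t, ht1, ht2, ht3⟩ := M.exists_short_mod (M.st q (w.take i)) (w.drop i) hg1
  rw [← M.st_append q (w.take i) (w.drop i), List.take_append_drop] at ht1
  change r.length < k * g at hr3
  change t.length < k * g at ht3
  set σ := M.st q (w.take i) with hσ
  have br := abs_le.1 (M.abs_ef_le q r)
  have bt := abs_le.1 (M.abs_ef_le σ t)
  have hkg : k * g ≤ k ^ 2 := by nlinarith
  have hE : ((Nat.gcd β b : ℕ) : ℤ) ∣ (m : ℤ) - h + M.ef q r + M.ef σ t := by
    have h1 := (hr2.add ht2).symm.dvd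
    rw [hσ, ← M.ef_append q (w.take i) (w.drop i), List.take_append_drop] at h1
    have e : (m : ℤ) - h + M.ef q r + M.ef σ t = M.ef q r + M.ef σ t - M.ef q w := by
      rw [hh]; ring
    rwa [e]
  obtain ⟨d, hd1, hd2, c, hc⟩ := exists_mul_modEq hβ1 hb hE (2 * t.length)
  have hd3 : d * β ≤ 3 * k ^ 2 := by
    have h1 : g * (d * β) ≤ g * (3 * k ^ 2) := by
      have h2 : β * b ≤ g * k ^ 2 := by nlinarith
      have h3 : g * (2 * t.length) ≤ g * (2 * k ^ 2) := Nat.mul_le_mul_left _ (by omega)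
      rw [← hg] at hd2
      linarith
    exact Nat.le_of_mul_le_mul_left h1 hg1
  have hd4 : d ≤ 3 * k := by
    have h1 : (g * β) * d ≤ (g * β) * (3 * k) := by
      have h2 : β * b ≤ β * (k * g) :=
        Nat.mul_le_mul_left _ (hbk.trans (Nat.le_mul_of_pos_right k hg1))
      have h3 : g * (2 * t.length) ≤ g * (2 * (k * β)) :=
        Nat.mul_le_mul_left _ (by have := Nat.mul_le_mul_left k hgβ; omega)
      rw [← hg] at hd2
      linarith
    exact Nat.le_of_mul_le_mul_left h1 (by positivity)
  have hcneg : c ≤ 0 := by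
    by_contra! hpos
    have h1 : 0 < (b : ℤ) * c := by positivity
    have h2 : ((d * β : ℕ) : ℤ) ≤ (3 * k ^ 2 : ℕ) := by exact_mod_cast hd3
    push_cast at h2
    have h3 : ((5 * k ^ 2 + h : ℕ) : ℤ) ≤ m := by exact_mod_cast hm
    have h4 : ((k * g : ℕ) : ℤ) ≤ (k ^ 2 : ℕ) := by exact_mod_cast hkg
    push_cast at h3 h4
    have h5 : (r.length : ℤ) < k * g := by exact_mod_cast hr3
    have h6 : (t.length : ℤ) < k * g := by exact_mod_cast ht3
    linarith
  obtain ⟨c', hc'⟩ : ∃ c' : ℕ, (c' : ℤ) = -c := ⟨_, Int.toNat_of_nonneg (by omega)⟩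
  have hsum : (c' : ℤ) * b + d * β = m - h + M.ef q r + M.ef σ t := by
    rw [hc']; linarith
  have hd1' : (2 * t.length : ℤ) ≤ d * β := by exact_mod_cast hd1
  have hk2 : k ≤ k ^ 2 := by nlinarith
  obtain ⟨y₁, hy₁⟩ : ∃ y : ℕ, (y : ℤ) = m + M.ef q r := ⟨_, Int.toNat_of_nonneg (by omega)⟩
  obtain ⟨y₂, hy₂⟩ : ∃ y : ℕ, (y : ℤ) = y₁ - c' * b := ⟨_, Int.toNat_of_nonneg (by omega)⟩
  obtain ⟨y₃, hy₃⟩ : ∃ y : ℕ, (y : ℤ) = y₂ + M.ef σ t := ⟨_, Int.toNat_of_nonneg (by omega)⟩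
  refine ⟨r ++ wpow s c' ++ t ++ wpow v d, ?_, ?_⟩
  · have e1 : M.crun (q, m) r = (σ, y₁) := by
      rw [← hr1]
      exact M.crun_of_length_le q m y₁ r (by omega) hy₁
    have e2 : M.crun (σ, y₁) (wpow s c') = (σ, y₂) :=
      M.crun_wpow hscl c' y₁ y₂ (by omega) (by omega) (by rw [hsb, hy₂]; ring)
    have e3 : M.crun (σ, y₂) t = (M.st q w, y₃) := by
      rw [← ht1]
      exact M.crun_of_length_le σ y₂ y₃ t (by omega) hy₃
    have e4 : M.crun (M.st q w, y₃) (wpow v d) = (M.st q w, h) :=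
      M.crun_wpow hvcl d y₃ h (by omega) (by omega) (by
        have : M.ef (M.st q w) v = -β := by omega
        rw [this]
        linarith)
    rw [M.crun_append, M.crun_append, M.crun_append, e1, e2, e3, e4]
  · simp only [List.length_append, length_wpow, hsa]
    have h1 : c' * b ≤ m + 2 * (k * g) := by
      zify
      have h5 : (r.length : ℤ) < k * g := by exact_mod_cast hr3
      have h6 : (t.length : ℤ) < k * g := by exact_mod_cast ht3
      omega
    have h2 : d * v.length ≤ 3 * k ^ 2 := by
      calc d * v.length ≤ (3 * k) * k := Nat.mul_le_mul hd4 hv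
        _ = 3 * k ^ 2 := by ring
    have h3 : a * (c' * b) ≤ a * m + 2 * k ^ 2 * b := by
      have h4 : a * (k * g) ≤ k ^ 2 * b := by
        calc a * (k * g) ≤ k * (k * b) := by gcongr; omega
          _ = k ^ 2 * b := by ring
      calc a * (c' * b) ≤ a * (m + 2 * (k * g)) := Nat.mul_le_mul_left _ h1
        _ = a * m + 2 * (a * (k * g)) := by ring
        _ ≤ a * m + 2 * k ^ 2 * b := by linarith
    have h5 : b * (r.length + t.length + d * v.length) ≤ b * (5 * k ^ 2) :=
      Nat.mul_le_mul_left _ (by omega)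
    linarith

/-- The length of a shortest run from a large counter value to small configurations is, up to an
error quadratic in the number of states, a ratio of small numbers times the counter value. -/
theorem exists_rate (K : ℕ) (hK : Fintype.card M.Q + 1 ≤ K) (T : M.Q × ℕ → Prop)
    (hT : ∀ z, T z → z.2 < K) (q : M.Q) (m : ℕ) (hm : 10 * K ^ 2 ≤ m) (w : List A)
    (hw : T (M.crun (q, m) w)) (hmin : ∀ w', T (M.crun (q, m) w') → w.length ≤ w'.length) :
    ∃ a b : ℕ, 1 ≤ a ∧ a ≤ Fintype.card M.Q ∧ 1 ≤ b ∧ b ≤ Fintype.card M.Q ∧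
      a * m ≤ b * w.length + a * (2 * K + 2 * Fintype.card M.Q) ∧
      b * w.length ≤ a * m +
        b * (25 * Fintype.card M.Q ^ 2 + 2 * Fintype.card M.Q * K + Fintype.card M.Q) := by
  classical
  have hk : 1 ≤ Fintype.card M.Q := Fintype.card_pos_iff.2 ⟨q⟩
  set k := Fintype.card M.Q with hkdef
  set H : ℕ → ℕ := fun i => (M.crun (q, m) (w.take i)).2 with hH
  have hstep : ∀ i, H (i + 1) ≤ H i + 1 ∧ H i ≤ H (i + 1) + 1 := M.crun_take_succ_le (q, m) w
  have hH0 : H 0 = m := rfl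
  have hHend : H w.length < K := by
    simp only [hH, List.take_length]; exact hT _ hw
  have hKK : K ≤ K ^ 2 := by nlinarith
  have hkK : k ^ 2 ≤ K ^ 2 := Nat.pow_le_pow_left (by omega) 2
  obtain ⟨e, heL, hew, he'⟩ : ∃ e, H e ≤ 2 * K ∧ e ≤ w.length ∧ ∀ i < e, 2 * K < H i := by
    have hex : ∃ i, H i ≤ 2 * K := ⟨w.length, by omega⟩
    exact ⟨Nat.find hex, Nat.find_spec hex, Nat.find_min' hex (by omega),
      fun i hi => not_le.1 (Nat.find_min hex hi)⟩
  have he0 : e ≠ 0 := by rintro rfl; omega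
  obtain ⟨f, hfe, hf, hf'⟩ : ∃ f < e, 2 * K + k ≤ H f ∧ ∀ i, f < i → i ≤ e → H i < 2 * K + k := by
    have h1 := Nat.findGreatest_spec (P := fun i => 2 * K + k ≤ H i) (Nat.zero_le e) (by omega)
    refine ⟨Nat.findGreatest (fun i => 2 * K + k ≤ H i) e, ?_, h1, fun i hi hi' => not_le.1
      (Nat.findGreatest_is_greatest (P := fun i => 2 * K + k ≤ H i) hi hi')⟩
    refine lt_of_le_of_ne (Nat.findGreatest_le e) fun h => ?_
    rw [h] at h1
    omega
  have hHe : 2 * K ≤ H e := by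
    have h1 := he' (e - 1) (by omega)
    have h2 := hstep (e - 1)
    rw [Nat.sub_add_cancel (by omega)] at h2
    omega
  have hHf : H f ≤ 2 * K + k := by
    have h1 := hf' (f + 1) (by omega) (by omega)
    have h2 := hstep f
    omega
  have hseg : ∀ i j, i ≤ j → j ≤ e →
      (M.crun (q, m) (w.take j)).1 = M.st (M.crun (q, m) (w.take i)).1 ((w.take j).drop i) ∧
      (H j : ℤ) = H i + M.ef (M.crun (q, m) (w.take i)).1 ((w.take j).drop i) := by
    intro i j h h'
    refine M.crun_segment _ w h (h'.trans hew) fun l hl hl' => ?_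
    have := he' l (by omega)
    simp only [hH] at this
    omega
  obtain ⟨p, hpf, hpe, v, hv, hvcl, hneg⟩ : ∃ p, f ≤ p ∧ p ≤ e ∧ ∃ v, v.length ≤ k ∧
      M.st (M.crun (q, m) (w.take p)).1 v = (M.crun (q, m) (w.take p)).1 ∧
      M.ef (M.crun (q, m) (w.take p)).1 v < 0 := by
    have h1 := hseg f e hfe.le le_rfl
    obtain ⟨l, hl, v, hvk, hv, hv'⟩ := M.exists_loop_of_ef (-1) (by simp)
      (M.crun (q, m) (w.take f)).1 ((w.take e).drop f) (by omega)
    have hl' : l ≤ e - f := by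
      rw [List.length_drop, List.length_take] at hl
      omega
    rw [List.take_drop, List.take_take, min_eq_left (by omega),
      ← (hseg f (f + l) (by omega) (by omega)).1] at hv hv'
    exact ⟨f + l, by omega, by omega, v, hvk, hv, by linarith⟩
  have hHp : 2 * K ≤ H p ∧ H p ≤ 2 * K + k := by
    constructor
    · rcases eq_or_lt_of_le hpe with rfl | h
      · exact hHe
      · exact (he' p h).le
    · rcases eq_or_lt_of_le hpf with rfl | h
      · exact hHf
      · exact (hf' p h hpe).le
  have hp := hseg 0 p (Nat.zero_le _) hpe
  simp only [List.take_zero, crun_nil, List.drop_zero, hH0] at hp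
  set u := w.take p with hu
  have hul : u.length ≤ w.length := by simp [hu]
  rw [hp.1] at hvcl hneg
  obtain ⟨i, s, b, hs, hscl, hb, hsb, hlow⟩ := M.exists_best_loop q u v hv hvcl hneg
  have hbs := M.neg_le_ef (M.st q (u.take i)) s
  obtain ⟨w₁, hw₁, hw₁l⟩ := M.exists_descent q m (H p) u s v i s.length b hs rfl hscl hb hsb hv
    hvcl hneg hp.2 (show k ≤ H p by omega) (show 5 * k ^ 2 + H p ≤ m by omega)
  change b * w₁.length ≤ s.length * m + 7 * k ^ 2 * b at hw₁l
  have hsplit : M.crun (M.st q u, H p) (w.drop p) = M.crun (q, m) w := by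
    rw [← hp.1]
    change M.crun (M.crun (q, m) (w.take p)) (w.drop p) = _
    rw [← M.crun_append, List.take_append_drop]
  obtain ⟨w₂, hw₂, hw₂l⟩ := M.exists_short_crun (L := 2 * K + k)
    (show 2 * k + 1 ≤ 2 * K + k by omega) (M.st q u, H p) (w.drop p) hHp.2 (by rw [hsplit]; have := hT _ hw; omega)
  rw [hsplit] at hw₂
  have hD := hmin (w₁ ++ w₂) (by rw [M.crun_append, hw₁, hw₂]; exact hw)
  rw [List.length_append] at hD
  refine ⟨s.length, b, by omega, hs, hb, by omega, ?_, ?_⟩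
  · have h1 : (b : ℤ) * u.length ≤ b * w.length := by gcongr
    have h2 : (s.length : ℤ) * H p ≤ s.length * (2 * K + k) := by
      gcongr
      exact_mod_cast hHp.2
    have h3 : M.ef q u = H p - m := by linarith [hp.2]
    rw [h3] at hlow
    zify
    linarith
  · have h1 : b * w₂.length ≤ b * (k * (2 * K + k + 2 * k + 1) + 15 * k ^ 2) :=
      Nat.mul_le_mul_left _ hw₂l
    have h2 := Nat.mul_le_mul_left b hD
    linarith

end DWROCA

namespace DWROCA

/-! ### Weights and the distance to `NWA` -/

lemma val_mul (M : DWROCA A S) (q : M.Q) (n : ℕ) (r s : S) (w : List A) :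
    M.val (q, n, r * s) w = r * M.val (q, n, s) w := by
  induction w generalizing q n s with
  | nil => rfl
  | cons x w ih =>
    change M.val (M.step (q, n, r * s) x) w = r * M.val (M.step (q, n, s) x) w
    simp only [step, mul_assoc]
    exact ih _ _ _

lemma uval_mul (M : DWROCA A S) (q : M.Q) (r s : S) (w : List A) :
    M.uval (q, r * s) w = r * M.uval (q, s) w := by
  induction w generalizing q s with
  | nil => rfl
  | cons x w ih =>
    change M.uval (M.ustep (q, r * s) x) w = r * M.uval (M.ustep (q, s) x) w
    simp only [ustep, mul_assoc]
    exact ih _ _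

lemma run_eq (M : DWROCA A S) (q : M.Q) (n : ℕ) (s : S) (w : List A) :
    ∃ r : S, r ≠ 0 ∧
      M.run (q, n, s) w = ((M.crun (q, n) w).1, (M.crun (q, n) w).2, r * s) := by
  induction w generalizing q n s with
  | nil => exact ⟨1, one_ne_zero, by simp [run]⟩
  | cons x w ih =>
    obtain ⟨r, hr, h⟩ := ih (M.step (q, n, s) x).1 (M.step (q, n, s) x).2.1 (M.step (q, n, s) x).2.2
    refine ⟨r * M.wt q (decide (n = 0)) x, mul_ne_zero hr (M.wt_ne _ _ _), ?_⟩
    change M.run (M.step (q, n, s) x) w = _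
    rw [h, mul_assoc, mul_comm _ s]
    rfl

lemma val_eq_uval (M : DWROCA A S) (q : M.Q) (n : ℕ) (s : S) (w : List A) (h : w.length ≤ n) :
    M.val (q, n, s) w = M.uval (q, s) w := by
  induction w generalizing q n s with
  | nil => rfl
  | cons x w ih =>
    rw [List.length_cons] at h
    have hn : decide (n = 0) = false := by simp; omega
    have hu := abs_le.1 (M.abs_upd_le q false x)
    change M.val (M.step (q, n, s) x) w = M.uval (M.ustep (q, s) x) w
    simp only [step, ustep, hn]
    exact ih _ _ _ (by omega)

lemma inNWA_mul {A₁ A₂ M : DWROCA A S} {K n : ℕ} {q : M.Q} {r s : S} (hr : r ≠ 0)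
    (h : inNWA A₁ A₂ M (q, n, s) K) : inNWA A₁ A₂ M (q, n, r * s) K := by
  have key : ∀ (N : DWROCA A S) (d : N.Q × S), kEquivU M N (q, n, r * s) d K →
      kEquivU M N (q, n, s) (d.1, r⁻¹ * d.2) K := by
    intro N d hd w hw
    rw [uval_mul, ← hd w hw, val_mul, inv_mul_cancel_left₀ hr]
  exact ⟨fun d hd => h.1 _ (key A₁ d hd), fun d hd => h.2 _ (key A₂ d hd)⟩

lemma not_inNWA_of_kEquivU {A₁ A₂ M : DWROCA A S} (hM : M = A₁ ∨ M = A₂) {K : ℕ} {c : M.Cfg}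
    {d : M.Q × S} (h : kEquivU M M c d K) : ¬ inNWA A₁ A₂ M c K := by
  rcases hM with rfl | rfl
  · exact fun h' => h'.1 d h
  · exact fun h' => h'.2 d h

lemma lt_of_inNWA {A₁ A₂ M : DWROCA A S} (hM : M = A₁ ∨ M = A₂) {K n : ℕ} {q : M.Q} {s : S}
    (h : inNWA A₁ A₂ M (q, n, s) K) : n < K := by
  by_contra! hn
  exact not_inNWA_of_kEquivU hM (fun w hw => M.val_eq_uval q n s w (hw.trans hn)) h

lemma ne_zero_of_inNWA {A₁ A₂ M : DWROCA A S} (hM : M = A₁ ∨ M = A₂) {K n : ℕ} {q : M.Q} {s : S}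
    (h : inNWA A₁ A₂ M (q, n, s) K) : s ≠ 0 := by
  rintro rfl
  refine not_inNWA_of_kEquivU hM (d := (q, 0)) (fun w _ => ?_) h
  have h1 := M.val_mul q n 0 0 w
  have h2 := M.uval_mul q 0 0 w
  rw [zero_mul, zero_mul] at h1 h2
  rw [h1, h2]

/-- A finite distance to `NWA` is the length of a shortest run without weights into the set of
members of `NWA` of weight one. -/
lemma exists_word_of_distNWA {A₁ A₂ M : DWROCA A S} (hM : M = A₁ ∨ M = A₂) {K D : ℕ} {c : M.Cfg}
    (hD : distNWA A₁ A₂ M c K = D) :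
    (∃ w, w.length = D ∧ inNWA A₁ A₂ M
      ((M.crun (c.1, c.2.1) w).1, (M.crun (c.1, c.2.1) w).2, 1) K) ∧
    ∀ w, inNWA A₁ A₂ M ((M.crun (c.1, c.2.1) w).1, (M.crun (c.1, c.2.1) w).2, 1) K →
      D ≤ w.length := by
  obtain ⟨q, n, s⟩ := c
  have hne : {n' : ℕ∞ | ∃ w : List A, (w.length : ℕ∞) = n' ∧
      inNWA A₁ A₂ M (M.run (q, n, s) w) K}.Nonempty := by
    by_contra h
    rw [Set.not_nonempty_iff_eq_empty] at h
    rw [distNWA, h, sInf_empty] at hD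
    exact ENat.natCast_ne_top D hD.symm
  obtain ⟨w, hw, hw'⟩ := csInf_mem hne
  change _ = distNWA A₁ A₂ M (q, n, s) K at hw
  rw [hD] at hw
  obtain ⟨r, hr, h⟩ := M.run_eq q n s w
  rw [h] at hw'
  have hs : s ≠ 0 := right_ne_zero_of_mul (ne_zero_of_inNWA hM hw')
  refine ⟨⟨w, by exact_mod_cast hw, ?_⟩, fun w' h' => ?_⟩
  · have := inNWA_mul (inv_ne_zero (mul_ne_zero hr hs)) hw'
    rwa [inv_mul_cancel₀ (mul_ne_zero hr hs)] at this
  · obtain ⟨r', hr', h1⟩ := M.run_eq q n s w'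
    have h2 := inNWA_mul (mul_ne_zero hr' hs) h'
    rw [mul_one, ← h1] at h2
    have h3 : distNWA A₁ A₂ M (q, n, s) K ≤ w'.length := sInf_le ⟨w', rfl, h2⟩
    rw [hD] at h3
    exact_mod_cast h3

/-- The relation between a counter value and a finite distance to `NWA`. -/
lemma distNWA_bounds {A₁ A₂ M : DWROCA A S} (hM : M = A₁ ∨ M = A₂) {K D : ℕ}
    (hK : Fintype.card M.Q + 1 ≤ K) {c : M.Cfg} (hD : distNWA A₁ A₂ M c K = D) :
    c.2.1 ≤ D + K ∧
    (c.2.1 < 10 * K ^ 2 → D ≤ Fintype.card M.Q * (10 * K ^ 2 + 2 * Fintype.card M.Q + 1) +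
      15 * Fintype.card M.Q ^ 2) ∧
    (10 * K ^ 2 ≤ c.2.1 → ∃ a b : ℕ,
      1 ≤ a ∧ a ≤ Fintype.card M.Q ∧ 1 ≤ b ∧ b ≤ Fintype.card M.Q ∧
      a * c.2.1 ≤ b * D + a * (2 * K + 2 * Fintype.card M.Q) ∧
      b * D ≤ a * c.2.1 +
        b * (25 * Fintype.card M.Q ^ 2 + 2 * Fintype.card M.Q * K + Fintype.card M.Q)) := by
  obtain ⟨⟨w, rfl, hw⟩, hmin⟩ := exists_word_of_distNWA hM hD
  have hz := lt_of_inNWA hM hw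
  have hKK : K ≤ K ^ 2 := by nlinarith
  refine ⟨?_, fun h => ?_, fun h => ?_⟩
  · have := M.crun_take_snd_le' (c.1, c.2.1) w 0 (Nat.zero_le _)
    simp only [List.take_zero, crun_nil] at this
    omega
  · obtain ⟨w', hw', hl⟩ := M.exists_short_crun (L := 10 * K ^ 2) (by omega) (c.1, c.2.1) w h.le
      (by omega)
    exact (hmin w' (by rwa [hw'])).trans hl
  · exact M.exists_rate K hK (fun z => inNWA A₁ A₂ M (z.1, z.2, 1) K)
      (fun z hz => lt_of_inNWA hM hz) c.1 c.2.1 h w hw hmin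

end DWROCA

/-! ### Belts -/

lemma belt_arith {k l : ℕ} (hk : 1 ≤ k) (hl : 1 ≤ l) :
    k * l * (25 * l ^ 2 + 2 * l * (k + l) + l + (2 * (k + l) + 2 * k)) ≤ 6 * (k + l) ^ 4 := by
  have h1 : k * l ^ 2 ≤ k ^ 2 * l ^ 2 := Nat.mul_le_mul_right _ (by nlinarith)
  have h2 : k ^ 2 * l ≤ k ^ 2 * l ^ 2 := Nat.mul_le_mul_left _ (by nlinarith)
  zify at *
  have h3 : (0 : ℤ) ≤ l ^ 2 * (27 * k ^ 2 - 3 * k * l + 6 * l ^ 2) :=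
    mul_nonneg (sq_nonneg _) (by nlinarith [sq_nonneg ((k : ℤ) - l)])
  have h4 : (0 : ℤ) ≤ 6 * k ^ 4 + 24 * (k ^ 3 * l) := by positivity
  linarith

lemma belt_upper {k l m n D a b a' b' : ℕ} (hk : 1 ≤ k) (hl : 1 ≤ l)
    (ha : a ≤ k) (hb : b ≤ k) (hb' : b' ≤ l)
    (h1 : a * m ≤ b * D + a * (2 * (k + l) + 2 * k))
    (h2 : b' * D ≤ a' * n + b' * (25 * l ^ 2 + 2 * l * (k + l) + l)) :
    a * b' * m ≤ b * a' * n + 6 * (k + l) ^ 4 := by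
  have e1 := Nat.mul_le_mul_left b' h1
  have e2 := Nat.mul_le_mul_left b h2
  have e3 : b * b' * (25 * l ^ 2 + 2 * l * (k + l) + l) ≤
      k * l * (25 * l ^ 2 + 2 * l * (k + l) + l) := by gcongr
  have e4 : a * b' * (2 * (k + l) + 2 * k) ≤ k * l * (2 * (k + l) + 2 * k) := by gcongr
  have e5 := belt_arith hk hl
  linarith

/-- The components of a belt may be taken co-prime. -/
lemma exists_coprime_belt {a b B : ℕ} {m n d : ℤ} (ha : 1 ≤ a) (haB : a ≤ B) (hb : 1 ≤ b)
    (hbB : b ≤ B) (h : |(a : ℤ) * m - b * n| ≤ d) :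
    ∃ p : ℕ × ℕ, 1 ≤ p.1 ∧ p.1 ≤ B ∧ 1 ≤ p.2 ∧ p.2 ≤ B ∧ Nat.Coprime p.1 p.2 ∧
      |(p.1 : ℤ) * m - p.2 * n| ≤ d := by
  obtain ⟨g, a', b', hg, hcop, rfl, rfl⟩ := Nat.exists_coprime' (Nat.gcd_pos_of_pos_left b ha)
  have h1 : 1 ≤ a' := Nat.pos_of_mul_pos_right ha
  have h2 : 1 ≤ b' := Nat.pos_of_mul_pos_right hb
  refine ⟨(a', b'), h1, (Nat.le_mul_of_pos_right a' hg).trans haB, h2,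
    (Nat.le_mul_of_pos_right b' hg).trans hbB, hcop, ?_⟩
  have e : ((a' * g : ℕ) : ℤ) * m - (b' * g : ℕ) * n = (a' * m - b' * n) * g := by
    push_cast; ring
  rw [e, abs_mul, Nat.abs_cast] at h
  have hg' : (1 : ℤ) ≤ g := by exact_mod_cast hg
  exact (le_mul_of_one_le_right (abs_nonneg _) hg').trans h

/-- A point far from the origin lies in at most one of the belts with small components. -/
lemma belt_unique {a b a' b' B : ℕ} {m n d : ℤ} (haB : a ≤ B)
    (hbB : b ≤ B) (hab : Nat.Coprime a b) (haB' : a' ≤ B) (hbB' : b' ≤ B)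
    (hab' : Nat.Coprime a' b') (h : |(a : ℤ) * m - b * n| ≤ d) (h' : |(a' : ℤ) * m - b' * n| ≤ d)
    (hbig : 2 * B * d < max |m| |n|) : a = a' ∧ b = b' := by
  have hd : 0 ≤ d := (abs_nonneg _).trans h
  suffices hdet : (a : ℤ) * b' = a' * b by
    have hdet : a * b' = a' * b := by exact_mod_cast hdet
    exact ⟨Nat.dvd_antisymm (hab.dvd_of_dvd_mul_right ⟨b', hdet.symm⟩)
        (hab'.dvd_of_dvd_mul_right ⟨b, hdet⟩),
      Nat.dvd_antisymm (hab.symm.dvd_of_dvd_mul_left ⟨a', hdet.trans (mul_comm _ _)⟩)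
        (hab'.symm.dvd_of_dvd_mul_left ⟨a, hdet.symm.trans (mul_comm _ _)⟩)⟩
  by_contra hne
  have hdet : 1 ≤ |(a : ℤ) * b' - a' * b| := Int.one_le_abs (sub_ne_zero.2 hne)
  have key : ∀ x y : ℕ, x ≤ B → y ≤ B →
      |(x : ℤ) * (a * m - b * n) - y * (a' * m - b' * n)| ≤ 2 * B * d := by
    intro x y hx hy
    refine (abs_sub _ _).trans ?_
    rw [abs_mul, abs_mul, Nat.abs_cast, Nat.abs_cast]
    have e1 : (x : ℤ) * |a * m - b * n| ≤ B * d := by gcongr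
    have e2 : (y : ℤ) * |a' * m - b' * n| ≤ B * d := by gcongr
    linarith
  have hm := key b' b hbB' hbB
  have hn := key a' a haB' haB
  have em : (b' : ℤ) * (a * m - b * n) - b * (a' * m - b' * n) = (a * b' - a' * b) * m := by ring
  have en : (a' : ℤ) * (a * m - b * n) - a * (a' * m - b' * n) = (a * b' - a' * b) * n := by ring
  rw [em, abs_mul] at hm
  rw [en, abs_mul] at hn
  have hm' := le_mul_of_one_le_left (abs_nonneg m) hdet
  have hn' := le_mul_of_one_le_left (abs_nonneg n) hdet
  rcases lt_max_iff.1 hbig with h | h <;> linarith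

/-- an unresolved configuration pair with `max{m,n} > 14K⁶` lies
in a unique belt of thickness `6K⁴` and slope `α/β` with co-prime
`α, β ∈ [1, K²]`. -/
theorem unresolved_in_unique_belt {A S : Type} [Field S]
    (A₁ A₂ : DWROCA A S) (K : ℕ)
    (hK : K = Fintype.card A₁.Q + Fintype.card A₂.Q)
    (χ : A₁.Cfg) (ψ : A₂.Cfg)
    (hunres : unresolved A₁ A₂ χ ψ K)
    (hbig : max χ.2.1 ψ.2.1 > 14 * K ^ 6) :
    ∃! p : ℕ × ℕ,
      1 ≤ p.1 ∧ p.1 ≤ K ^ 2 ∧ 1 ≤ p.2 ∧ p.2 ≤ K ^ 2 ∧ Nat.Coprime p.1 p.2 ∧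
        |(p.1 : ℤ) * (χ.2.1 : ℤ) - (p.2 : ℤ) * (ψ.2.1 : ℤ)| ≤ (6 * K ^ 4 : ℤ) := by
  obtain ⟨-, hdist, hfin⟩ := hunres
  obtain ⟨D, hD⟩ := ENat.ne_top_iff_exists.1 hfin
  have hk : 1 ≤ Fintype.card A₁.Q := Fintype.card_pos_iff.2 ⟨χ.1⟩
  have hl : 1 ≤ Fintype.card A₂.Q := Fintype.card_pos_iff.2 ⟨ψ.1⟩
  obtain ⟨u₁, t₁, r₁⟩ := DWROCA.distNWA_bounds (A₁ := A₁) (A₂ := A₂) (Or.inl rfl) (by omega) hD.symm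
  obtain ⟨u₂, t₂, r₂⟩ := DWROCA.distNWA_bounds (A₁ := A₁) (A₂ := A₂) (Or.inr rfl) (by omega)
    (hdist.symm.trans hD.symm)
  generalize Fintype.card A₁.Q = k at *
  generalize Fintype.card A₂.Q = l at *
  obtain ⟨m, hm⟩ : ∃ m, m = χ.2.1 := ⟨_, rfl⟩
  obtain ⟨n, hn⟩ : ∃ n, n = ψ.2.1 := ⟨_, rfl⟩
  rw [← hm] at u₁ t₁ r₁
  rw [← hn] at u₂ t₂ r₂
  rw [← hm, ← hn] at hbig ⊢
  have hK2 : 2 ≤ K := by omega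
  have hDbig : 14 * K ^ 6 < D + K := hbig.trans_le (max_le u₁ u₂)
  have hsmall : ∀ x, x + 1 ≤ K → ¬ D ≤ x * (10 * K ^ 2 + 2 * x + 1) + 15 * x ^ 2 := by
    intro x hx hle
    have h1 : x * (10 * K ^ 2 + 2 * x + 1) + 15 * x ^ 2 ≤
        K * (10 * K ^ 2 + 2 * K + 1) + 15 * K ^ 2 := by gcongr <;> omega
    have h2 : K * (10 * K ^ 2 + 2 * K + 1) + 15 * K ^ 2 + K ≤ 14 * K ^ 6 := by
      have e1 : 2 * K ^ 2 ≤ K ^ 3 := by nlinarith [sq_nonneg K]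
      have e2 : 2 * K ≤ K ^ 2 := by nlinarith
      have e3 : K ^ 3 * 8 ≤ K ^ 3 * K ^ 3 :=
        Nat.mul_le_mul_left _ (Nat.pow_le_pow_left hK2 3)
      have e4 : K ^ 3 * K ^ 3 = K ^ 6 := by ring
      linarith
    omega
  obtain ⟨a, b, ha, hak, hb, hbk, h1, h2⟩ := r₁ (by by_contra! h; exact hsmall k (by omega) (t₁ h))
  obtain ⟨a', b', ha', hal, hb', hbl, h3, h4⟩ :=
    r₂ (by by_contra! h; exact hsmall l (by omega) (t₂ h))
  subst hK
  have up : a * b' * m ≤ b * a' * n + 6 * (k + l) ^ 4 := belt_upper hk hl hak hbk hbl h1 h4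
  have lo : a' * b * n ≤ b' * a * m + 6 * (l + k) ^ 4 :=
    belt_upper hl hk hal hbl hbk (by rwa [add_comm l k]) (by rwa [add_comm l k])
  have hkl : k * l ≤ (k + l) ^ 2 := by nlinarith
  obtain ⟨p, hp1, hp2, hp3, hp4, hp5, hp6⟩ := exists_coprime_belt (a := a * b') (b := b * a')
    (B := (k + l) ^ 2) (m := m) (n := n) (d := 6 * ((k + l : ℕ) : ℤ) ^ 4)
    (Nat.mul_pos ha hb') ((Nat.mul_le_mul hak hbl).trans hkl)
    (Nat.mul_pos hb ha') ((Nat.mul_le_mul hbk hal).trans hkl) (by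
      rw [abs_le]
      zify at up lo
      push_cast
      rw [add_comm (l : ℤ)] at lo
      constructor <;> linarith)
  refine ⟨p, ⟨hp1, hp2, hp3, hp4, hp5, hp6⟩, ?_⟩
  rintro p' ⟨hp1', hp2', hp3', hp4', hp5', hp6'⟩
  have := belt_unique hp2' hp4' hp5' hp2 hp4 hp5 hp6' hp6 (by
    rw [Nat.abs_cast, Nat.abs_cast]
    have h5 : 2 * (k + l) ^ 2 * (6 * (k + l) ^ 4) < max m n := by
      refine lt_of_le_of_lt ?_ hbig
      have : 2 * (k + l) ^ 2 * (6 * (k + l) ^ 4) = 12 * (k + l) ^ 6 := by ring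
      omega
    exact_mod_cast h5)
  exact Prod.ext this.1 this.2
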